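/- arXiv:math/0607396 — 3 statements merged into one kernel-verified Lean document; each statement's English description precedes it below -/
import Mathlib

section
/- Every facet of a d-braxtope Q^{d,n} (n ≥ d ≥ 3) is a (d-1)-braxtope with the vertex ordering induced from x_0 < x_1 < ... < x_n; that is, Q is braxial. -/
open Set

noncomputable section

variable {V : Type*} [NormedAddCommGroup V] [NormedSpace ℝ V]

open Classical in
/-- Affine dimension of a set: `-1` for the empty set, otherwise the
dimension of its affine hull. -/
def sdim (s : Set V) : ℤ :=
  if s.Nonempty then (Module.finrank ℝ (affineSpan ℝ s).direction : ℤ) else -1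

/-- `F` is a face of the polytope `Q`. -/
def IsFaceOf (Q F : Set V) : Prop :=
  IsExtreme ℝ Q F ∧ Convex ℝ F ∧ IsClosed F

/-- `F` is a facet of the `d`-polytope `Q`. -/
def IsFacetOf (d : ℕ) (Q F : Set V) : Prop :=
  IsFaceOf Q F ∧ sdim F = (d : ℤ) - 1

/-- The segment `[a, b]` is an edge (a 1-dimensional face) of `Q`. -/
def IsEdgeOf (Q : Set V) (a b : V) : Prop :=
  IsFaceOf Q (segment ℝ a b) ∧ sdim (segment ℝ a b) = 1

/-- Clamped vertex indexing: `x_t = x_0` for `t ≤ 0` and `x_t = x_n` for `t ≥ n`. -/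
def xc {n : ℕ} (x : Fin (n + 1) → V) (t : ℤ) : V :=
  x ⟨(min (max t 0) n).toNat, by omega⟩

/-- The polytope spanned by the vertex array `x`. -/
def braxQ {n : ℕ} (x : Fin (n + 1) → V) : Set V :=
  convexHull ℝ (Set.range x)

/-- Vertex set of the simplex facet `T_i = [x_i, …, x_{i+d-1}]`. -/
def Tset (d : ℕ) {n : ℕ} (x : Fin (n + 1) → V) (i : ℤ) : Set V :=
  xc x '' Set.Icc i (i + (d : ℤ) - 1)

/-- Vertex set of the facet
`E_j = [x_0, x_{j-(d-2)}, …, x_{j-1}, x_{j+1}, …, x_{j+(d-2)}]`. -/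
def Eset (d : ℕ) {n : ℕ} (x : Fin (n + 1) → V) (j : ℤ) : Set V :=
  insert (x 0) (xc x '' (Set.Icc (j - ((d : ℤ) - 2)) (j + ((d : ℤ) - 2)) \ {j}))

/-- `x_0 < x_1 < ⋯ < x_n` is the vertex array of a `d`-braxtope: for `d ≤ 2` a
`d`-simplex; for `d ≥ 3` a `d`-polytope whose facets are exactly the `T_i`
(`0 ≤ i ≤ n - d + 1`) and the `E_j` (`2 ≤ j ≤ n`). -/
def IsBraxtope (d n : ℕ) (x : Fin (n + 1) → V) : Prop :=
  (d ≤ 2 → n = d ∧ AffineIndependent ℝ x) ∧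
  (3 ≤ d →
    d ≤ n ∧ Function.Injective x ∧
    sdim (braxQ x) = d ∧
    (∀ i, x i ∈ Set.extremePoints ℝ (braxQ x)) ∧
    (∀ F : Set V, IsFacetOf d (braxQ x) F ↔
      (∃ i : ℤ, 0 ≤ i ∧ i ≤ (n : ℤ) - d + 1 ∧ F = convexHull ℝ (Tset d x i)) ∨
      (∃ j : ℤ, 2 ≤ j ∧ j ≤ (n : ℤ) ∧ F = convexHull ℝ (Eset d x j))))


/-! ### Convex geometry of polytopes -/

lemma face_aff {P R : Set V} (hE : IsExtreme ℝ P R) (hR : Convex ℝ R) {y : V}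
    (hy : y ∈ P) (hya : y ∈ affineSpan ℝ R) : y ∈ R := by
  have h1 : y ∈ affineSpan ℝ (Set.range (Subtype.val : R → V)) := by simpa using hya
  obtain ⟨s, w, hw, hyw⟩ := eq_affineCombination_of_mem_affineSpan h1
  rw [Finset.affineCombination_eq_linear_combination _ _ _ hw] at hyw
  have hs : s.Nonempty := by
    rw [Finset.nonempty_iff_ne_empty]
    rintro rfl
    simp at hw
  have hk : (0 : ℝ) < s.card := by exact_mod_cast hs.card_pos
  -- a bound for the weights
  obtain ⟨M, hM0, hM⟩ : ∃ M : ℝ, 0 < M ∧ ∀ i ∈ s, w i ≤ M := by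
    refine ⟨∑ i ∈ s, |w i| + 1, by positivity, fun i hi => ?_⟩
    have := Finset.single_le_sum (f := fun i => |w i|) (fun i _ => abs_nonneg _) hi
    have h2 := le_abs_self (w i)
    linarith
  set k : ℝ := (s.card : ℝ) with hkdef
  set ε : ℝ := 1 / (k * M) with hε
  have hε0 : 0 < ε := by positivity
  have hεM : ε * M = 1 / k := by rw [hε]; field_simp
  set z : V := ∑ i ∈ s, (1 / k) • (i : V) with hz
  have hsum1 : ∑ i ∈ s, (1 / k) = 1 := by
    rw [Finset.sum_const, nsmul_eq_mul, ← hkdef]; field_simp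
  have hzR : z ∈ R := hR.sum_mem (fun i _ => by positivity) hsum1 (fun i _ => i.2)
  set u : V := ∑ i ∈ s, ((1 + ε) * (1 / k) - ε * w i) • (i : V) with hu
  have huR : u ∈ R := by
    refine hR.sum_mem (fun i hi => ?_) ?_ (fun i _ => i.2)
    · have := mul_le_mul_of_nonneg_left (hM i hi) hε0.le
      have h3 : 0 < ε * (1 / k) := by positivity
      nlinarith
    · rw [Finset.sum_sub_distrib, ← Finset.mul_sum, ← Finset.mul_sum, hsum1, hw]; ring
  have huz : u = (1 + ε) • z - ε • y := by
    rw [hu, hz, hyw, Finset.smul_sum, Finset.smul_sum, ← Finset.sum_sub_distrib]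
    refine Finset.sum_congr rfl fun i _ => ?_
    rw [sub_smul, mul_smul, mul_smul]
  refine hE.left_mem_of_mem_openSegment hy (hE.subset huR) hzR ?_
  refine ⟨ε / (1 + ε), 1 / (1 + ε), by positivity, by positivity, by field_simp; ring, ?_⟩
  rw [huz, smul_sub, smul_smul, smul_smul, one_div_mul_cancel (by positivity), one_smul,
    one_div_mul_eq_div]
  abel

lemma face_eq_hull {X : Set V} (hX : X.Finite) {R : Set V}
    (hR : IsFaceOf (convexHull ℝ X) R) : R = convexHull ℝ (X ∩ R) := by
  obtain ⟨hE, hc, hcl⟩ := hR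
  apply Set.Subset.antisymm
  · have hcomp : IsCompact R := (hX.isCompact_convexHull ℝ).of_isClosed_subset hcl hE.subset
    have h1 := closure_convexHull_extremePoints hcomp hc
    have h2 : Set.extremePoints ℝ R ⊆ X ∩ R := fun y hy =>
      ⟨extremePoints_convexHull_subset (hE.extremePoints_subset_extremePoints hy), hy.1⟩
    have h3 : IsClosed (convexHull ℝ (X ∩ R)) := (hX.inter_of_left R).isClosed_convexHull ℝ
    calc R = closure (convexHull ℝ (Set.extremePoints ℝ R)) := h1.symm
      _ ⊆ closure (convexHull ℝ (X ∩ R)) := closure_mono (convexHull_mono h2)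
      _ = _ := h3.closure_eq
  · exact convexHull_min Set.inter_subset_right hc

lemma sep_affine (A : AffineSubspace ℝ V) [FiniteDimensional ℝ A.direction]
    (hA : (A : Set V).Nonempty) {K : Set V} (hK : Convex ℝ K) (hKc : IsCompact K)
    (hd : Disjoint (A : Set V) K) :
    ∃ f : V →ᴬ[ℝ] ℝ, (∀ y ∈ A, f y = 0) ∧ ∀ y ∈ K, 0 < f y := by
  obtain ⟨f, u, v, h1, h2, h3⟩ := geometric_hahn_banach_closed_compact A.convex
    A.closed_of_finiteDimensional hK hKc hd
  obtain ⟨a0, ha0⟩ := hA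
  have hconst : ∀ a ∈ A, f a = f a0 := by
    intro a ha
    by_contra hne
    have hδ : f a - f a0 ≠ 0 := sub_ne_zero.mpr hne
    have hmem : AffineMap.lineMap a0 a ((u - f a0) / (f a - f a0)) ∈ A :=
      AffineMap.lineMap_mem _ ha0 ha
    have := h1 _ hmem
    rw [AffineMap.lineMap_apply] at this
    simp only [vsub_eq_sub, vadd_eq_add, map_add, map_smul, map_sub, smul_eq_mul] at this
    rw [div_mul_cancel₀ _ hδ] at this
    linarith
  refine ⟨f.toContinuousAffineMap - ContinuousAffineMap.const ℝ V (f a0), ?_, ?_⟩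
  · intro y hy
    simp [hconst y hy]
  · intro y hy
    have := h3 y hy
    have := h1 a0 ha0
    simp
    linarith

lemma fd_span {X : Set V} (hX : X.Finite) {R : Set V} (hR : R ⊆ convexHull ℝ X) :
    FiniteDimensional ℝ (affineSpan ℝ R).direction := by
  have h1 : affineSpan ℝ R ≤ affineSpan ℝ X := by
    rw [← affineSpan_convexHull (𝕜 := ℝ) X]
    exact affineSpan_mono ℝ hR
  have h2 := AffineSubspace.direction_le h1
  have : FiniteDimensional ℝ (affineSpan ℝ X).direction := by
    rw [direction_affineSpan]
    exact finiteDimensional_vectorSpan_of_finite ℝ hX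
  exact Submodule.finiteDimensional_of_le h2

lemma face_exposed {X : Set V} (hX : X.Finite) {R : Set V}
    (hR : IsFaceOf (convexHull ℝ X) R) (hne : R.Nonempty) :
    ∃ f : V →ᴬ[ℝ] ℝ, (∀ y ∈ R, f y = 0) ∧ ∀ y ∈ X, y ∉ R → 0 < f y := by
  have hfd := fd_span hX hR.1.subset
  have hXf : (X \ R).Finite := hX.subset Set.sdiff_subset
  have hsub : convexHull ℝ (X \ R) ⊆ convexHull ℝ X := convexHull_mono Set.sdiff_subset
  have hdisj : Disjoint (affineSpan ℝ R : Set V) (convexHull ℝ (X \ R)) := by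
    rw [Set.disjoint_left]
    intro y hy hyK
    have hyR : y ∈ R := face_aff hR.1 hR.2.1 (hsub hyK) hy
    have hface : IsFaceOf (convexHull ℝ (X \ R)) (R ∩ convexHull ℝ (X \ R)) := by
      refine ⟨⟨Set.inter_subset_right, ?_⟩, hR.2.1.inter (convex_convexHull ℝ _),
        hR.2.2.inter (hXf.isClosed_convexHull ℝ)⟩
      intro a ha b hb c hc hab
      exact ⟨hR.1.left_mem_of_mem_openSegment (hsub ha) (hsub hb) hc.1 hab, ha⟩
    have h := face_eq_hull hXf hface
    have h0 : (X \ R) ∩ (R ∩ convexHull ℝ (X \ R)) = ∅ := by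
      ext t; simp; tauto
    rw [h0, convexHull_empty] at h
    have : y ∈ (∅ : Set V) := h ▸ ⟨hyR, hyK⟩
    exact this
  obtain ⟨f, hf1, hf2⟩ := sep_affine (affineSpan ℝ R) ((affineSpan_nonempty ℝ).mpr hne)
    (convex_convexHull ℝ _) (hXf.isCompact_convexHull ℝ) hdisj
  exact ⟨f, fun y hy => hf1 y (subset_affineSpan ℝ R hy),
    fun y hy hyR => hf2 y (subset_convexHull ℝ _ ⟨hy, hyR⟩)⟩

lemma face_dim_lt {X : Set V} (hX : X.Finite) {R : Set V}
    (hE : IsExtreme ℝ (convexHull ℝ X) R) (hc : Convex ℝ R) (hne : R.Nonempty)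
    (hprop : R ≠ convexHull ℝ X) :
    Module.finrank ℝ (affineSpan ℝ R).direction
      < Module.finrank ℝ (affineSpan ℝ (convexHull ℝ X)).direction := by
  have := fd_span hX (subset_refl _)
  have hle := affineSpan_mono ℝ hE.subset
  have hd := AffineSubspace.direction_le hle
  by_contra hcon
  have h1 := Submodule.eq_of_le_of_finrank_le hd (not_lt.mp hcon)
  have h2 := AffineSubspace.eq_of_direction_eq_of_nonempty_of_le h1
    ((affineSpan_nonempty ℝ).mpr hne) hle
  apply hprop
  refine Set.Subset.antisymm hE.subset fun y hy => face_aff hE hc hy ?_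
  rw [h2]
  exact subset_affineSpan ℝ _ hy

lemma tilt_aux {X : Set V} (hX : X.Finite) {p : V} (N : ℕ) :
    ∀ f : V →ᴬ[ℝ] ℝ, {y ∈ X | f y ≠ 0}.ncard ≤ N → (∀ y ∈ X, 0 ≤ f y) → 0 < f p →
    ∃ g : V →ᴬ[ℝ] ℝ, (∀ y ∈ X, 0 ≤ g y) ∧ 0 < g p ∧ (∀ y ∈ X, f y = 0 → g y = 0) ∧
      X ⊆ affineSpan ℝ (insert p {y ∈ X | g y = 0}) := by
  induction N with
  | zero =>
    intro f hcard hpos hp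
    refine ⟨f, hpos, hp, fun _ _ h => h, fun y hy => subset_affineSpan ℝ _ (Or.inr ⟨hy, ?_⟩)⟩
    by_contra hne
    have hfin : {y ∈ X | f y ≠ 0}.Finite := hX.subset (Set.sep_subset _ _)
    have h0 := (Set.ncard_eq_zero hfin).mp (Nat.le_zero.mp hcard)
    have : y ∈ {y ∈ X | f y ≠ 0} := ⟨hy, hne⟩
    rw [h0] at this
    exact this
  | succ N ih =>
    intro f hcard hpos hp
    by_cases hsub : X ⊆ affineSpan ℝ (insert p {y ∈ X | f y = 0})
    · exact ⟨f, hpos, hp, fun _ _ h => h, hsub⟩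
    obtain ⟨q, hq, hqA⟩ := Set.not_subset.mp hsub
    set Z := insert p {y ∈ X | f y = 0} with hZ
    have hZf : Z.Finite := (hX.subset (Set.sep_subset _ _)).insert p
    have := fd_span hZf (subset_convexHull ℝ Z)
    obtain ⟨h', hh1, hh2⟩ := sep_affine (affineSpan ℝ Z)
      ((affineSpan_nonempty ℝ).mpr ⟨p, Or.inl rfl⟩) (convex_singleton q) isCompact_singleton
      (by rw [Set.disjoint_singleton_right]; exact hqA)
    set h : V →ᴬ[ℝ] ℝ := -h' with hh
    have hz : ∀ y ∈ Z, h y = 0 := fun y hy => by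
      simp [hh, hh1 y (subset_affineSpan ℝ _ hy)]
    have hqn : h q < 0 := by
      have := hh2 q rfl
      simp [hh, this]
    obtain ⟨y0, hy0, hmin⟩ := Set.exists_min_image {y ∈ X | h y < 0} (fun y => f y / (-h y))
      (hX.subset (Set.sep_subset _ _)) ⟨q, hq, hqn⟩
    set t := f y0 / (-h y0) with ht
    have hy0n : 0 < -h y0 := by linarith [hy0.2]
    have ht0 : 0 ≤ t := div_nonneg (hpos y0 hy0.1) hy0n.le
    set f' : V →ᴬ[ℝ] ℝ := f + t • h with hf'
    have hf'a : ∀ y, f' y = f y + t * h y := fun y => by simp [hf']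
    have hkeep : ∀ y ∈ X, f y = 0 → f' y = 0 := fun y hy h0 => by
      rw [hf'a, h0, hz y (Or.inr ⟨hy, h0⟩)]; simp
    have hf'y0 : f' y0 = 0 := by
      have : t * (-h y0) = f y0 := div_mul_cancel₀ _ hy0n.ne'
      rw [hf'a]; linarith
    have hfy0 : f y0 ≠ 0 := fun h0 => by
      have := hz y0 (Or.inr ⟨hy0.1, h0⟩)
      linarith
    have hpos' : ∀ y ∈ X, 0 ≤ f' y := by
      intro y hy
      rw [hf'a]
      rcases le_or_gt 0 (h y) with hy' | hy'
      · have := hpos y hy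
        positivity
      · have h1 := hmin y ⟨hy, hy'⟩
        have h2 : t * (-h y) ≤ f y := (le_div_iff₀ (by linarith)).mp h1
        linarith
    have hp' : 0 < f' p := by
      rw [hf'a, hz p (Or.inl rfl)]; simpa using hp
    have hlt : {y ∈ X | f' y ≠ 0}.ncard < {y ∈ X | f y ≠ 0}.ncard := by
      refine Set.ncard_lt_ncard ⟨?_, ?_⟩ (hX.subset (Set.sep_subset _ _))
      · rintro y ⟨hy, hy'⟩
        exact ⟨hy, fun h0 => hy' (hkeep y hy h0)⟩
      · intro hss
        exact (hss ⟨hy0.1, hfy0⟩ : y0 ∈ {y ∈ X | f' y ≠ 0}).2 hf'y0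
    obtain ⟨g, hg1, hg2, hg3, hg4⟩ := ih f' (by omega) hpos' hp'
    exact ⟨g, hg1, hg2, fun y hy h0 => hg3 y hy (hkeep y hy h0), hg4⟩

/-- Every nonempty face missing a vertex `p` lies in a facet missing `p`. -/
lemma exists_facet {X : Set V} (hX : X.Finite) {R : Set V}
    (hR : IsFaceOf (convexHull ℝ X) R) (hne : R.Nonempty) {p : V} (hp : p ∈ X) (hpR : p ∉ R) :
    ∃ G, IsFaceOf (convexHull ℝ X) G ∧ R ⊆ G ∧ p ∉ G ∧
      sdim G = sdim (convexHull ℝ X) - 1 := by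
  obtain ⟨f, hf1, hf2⟩ := face_exposed hX hR hne
  have hf0 : ∀ y ∈ X, 0 ≤ f y := fun y hy => by
    by_cases h : y ∈ R
    · exact (hf1 y h).ge
    · exact (hf2 y hy h).le
  obtain ⟨g, hg1, hg2, hg3, hg4⟩ := tilt_aux hX (p := p) _ f le_rfl hf0 (hf2 p hp hpR)
  have hcomb : ∀ (a b : V) (s t : ℝ), s + t = 1 → g (s • a + t • b) = s * g a + t * g b := by
    intro a b s t hst
    have := Convex.combo_affine_apply (f := (g : V →ᵃ[ℝ] ℝ)) (x := a) (y := b) hst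
    simpa using this
  have hQ : ∀ y ∈ convexHull ℝ X, 0 ≤ g y := by
    intro y hy
    have : convexHull ℝ X ⊆ {y | 0 ≤ g y} := by
      refine convexHull_min hg1 ?_
      intro a ha b hb s t hs ht hst
      simp only [Set.mem_ofPred_eq] at ha hb ⊢
      rw [hcomb _ _ _ _ hst]
      positivity
    exact this hy
  set G := convexHull ℝ X ∩ {y | g y = 0} with hG
  have hGface : IsFaceOf (convexHull ℝ X) G := by
    refine ⟨⟨Set.inter_subset_left, ?_⟩, (convex_convexHull ℝ X).inter ?_,
      (hX.isClosed_convexHull ℝ).inter (isClosed_eq g.continuous continuous_const)⟩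
    · rintro a ha b hb c hc ⟨s, t, hs, ht, hst, rfl⟩
      refine ⟨ha, ?_⟩
      have h0 := hc.2
      simp only [Set.mem_ofPred_eq] at h0 ⊢
      rw [hcomb _ _ _ _ hst] at h0
      have h1 := hQ a ha
      have h2 := hQ b hb
      have h3 : 0 ≤ t * g b := by positivity
      have h4 : 0 ≤ s * g a := by positivity
      have h5 : s * g a = 0 := by linarith
      exact (mul_eq_zero.mp h5).resolve_left hs.ne'
    · intro a ha b hb s t hs ht hst
      simp only [Set.mem_ofPred_eq] at ha hb ⊢
      rw [hcomb _ _ _ _ hst, ha, hb]; simp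
  have hRG : R ⊆ G := by
    rw [face_eq_hull hX hR]
    refine convexHull_min ?_ hGface.2.1
    rintro y ⟨hy, hyR⟩
    exact ⟨subset_convexHull ℝ _ hy, hg3 y hy (hf1 y hyR)⟩
  have hpG : p ∉ G := fun h => hg2.ne' h.2
  have hGne : G.Nonempty := hne.mono hRG
  refine ⟨G, hGface, hRG, hpG, ?_⟩
  have hpQ : p ∈ convexHull ℝ X := subset_convexHull ℝ _ hp
  have hlt := face_dim_lt hX hGface.1 hGface.2.1 hGne (fun h => hpG (h ▸ hpQ))
  have hle : Module.finrank ℝ (affineSpan ℝ (convexHull ℝ X)).direction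
      ≤ Module.finrank ℝ (affineSpan ℝ G).direction + 1 := by
    have hZG : {y ∈ X | g y = 0} ⊆ G := fun y hy => ⟨subset_convexHull ℝ _ hy.1, hy.2⟩
    have h1 : affineSpan ℝ X ≤ affineSpan ℝ (insert p G) :=
      affineSpan_le.mpr (hg4.trans (affineSpan_mono ℝ (Set.insert_subset_insert hZG)))
    have h2 := finrank_vectorSpan_insert_le_set ℝ G p
    have := fd_span hX (R := insert p G) (Set.insert_subset hpQ Set.inter_subset_left)
    have h3 := Submodule.finrank_mono (AffineSubspace.direction_le h1)
    rw [affineSpan_convexHull]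
    rw [direction_affineSpan ℝ (insert p G)] at h3
    rw [direction_affineSpan ℝ G]
    omega
  unfold sdim
  rw [if_pos hGne, if_pos ⟨p, hpQ⟩]
  omega

lemma hull_mem_iff {n : ℕ} {x : Fin (n + 1) → V} (hinj : Function.Injective x)
    (hext : ∀ i, x i ∈ Set.extremePoints ℝ (braxQ x)) (S : Set (Fin (n + 1))) (i : Fin (n + 1)) :
    x i ∈ convexHull ℝ (x '' S) ↔ i ∈ S := by
  constructor
  · intro h
    have hsub : convexHull ℝ (x '' S) ⊆ braxQ x := convexHull_mono (Set.image_subset_range x S)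
    have h1 := inter_extremePoints_subset_extremePoints_of_subset hsub ⟨h, hext i⟩
    obtain ⟨k, hk, hki⟩ := extremePoints_convexHull_subset h1
    exact hinj hki ▸ hk
  · intro h
    exact subset_convexHull ℝ _ ⟨i, h, rfl⟩

lemma face_inter {n : ℕ} {x : Fin (n + 1) → V} (hinj : Function.Injective x)
    (hext : ∀ i, x i ∈ Set.extremePoints ℝ (braxQ x)) {S S' : Set (Fin (n + 1))}
    (hS : IsFaceOf (braxQ x) (convexHull ℝ (x '' S)))
    (hS' : IsFaceOf (braxQ x) (convexHull ℝ (x '' S'))) :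
    IsFaceOf (braxQ x) (convexHull ℝ (x '' (S ∩ S'))) := by
  have hI : IsFaceOf (braxQ x) (convexHull ℝ (x '' S) ∩ convexHull ℝ (x '' S')) :=
    ⟨hS.1.inter hS'.1, hS.2.1.inter hS'.2.1, hS.2.2.inter hS'.2.2⟩
  have h := face_eq_hull (Set.finite_range x) hI
  have h2 : Set.range x ∩ (convexHull ℝ (x '' S) ∩ convexHull ℝ (x '' S')) = x '' (S ∩ S') := by
    ext y
    constructor
    · rintro ⟨⟨i, rfl⟩, h1, h2⟩
      exact ⟨i, ⟨(hull_mem_iff hinj hext S i).mp h1, (hull_mem_iff hinj hext S' i).mp h2⟩, rfl⟩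
    · rintro ⟨i, ⟨h1, h2⟩, rfl⟩
      exact ⟨⟨i, rfl⟩, (hull_mem_iff hinj hext S i).mpr h1, (hull_mem_iff hinj hext S' i).mpr h2⟩
  rw [h2] at h
  rw [← h]
  exact hI

lemma key {n : ℕ} {x : Fin (n + 1) → V} (hinj : Function.Injective x)
    (hext : ∀ i, x i ∈ Set.extremePoints ℝ (braxQ x)) {d : ℕ} (hd : 2 ≤ d)
    (hQd : sdim (braxQ x) = d)
    {Fm : Set (Set (Fin (n + 1)))}
    (hF : ∀ F : Set V, IsFacetOf d (braxQ x) F ↔ ∃ S ∈ Fm, F = convexHull ℝ (x '' S))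
    {m : ℕ} {g : Fin (m + 1) → Fin (n + 1)} (hg : Function.Injective g)
    (hS : Set.range g ∈ Fm) {Lm : Set (Set (Fin (m + 1)))}
    (hne : ∀ L ∈ Lm, L.Nonempty) (h0 : ∀ L ∈ Lm, L ≠ Set.univ)
    (h1 : ∀ L ∈ Lm, ∃ S' ∈ Fm, g ⁻¹' S' = L)
    (h2 : ∀ S' ∈ Fm, g ⁻¹' S' ≠ Set.univ → ∃ L ∈ Lm, g ⁻¹' S' ⊆ L)
    (h3 : ∀ L ∈ Lm, ∀ L' ∈ Lm, L ⊆ L' → L = L') (R : Set V) :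
    IsFacetOf (d - 1) (braxQ (x ∘ g)) R ↔ ∃ L ∈ Lm, R = convexHull ℝ ((x ∘ g) '' L) := by
  have hFeq : braxQ (x ∘ g) = convexHull ℝ (x '' Set.range g) := by
    rw [braxQ, Set.range_comp]
  have hFf : IsFacetOf d (braxQ x) (braxQ (x ∘ g)) := (hF _).mpr ⟨_, hS, hFeq⟩
  have hFsub : braxQ (x ∘ g) ⊆ braxQ x := hFf.1.1.subset
  have hinj' : Function.Injective (x ∘ g) := hinj.comp hg
  have hext' : ∀ i, (x ∘ g) i ∈ Set.extremePoints ℝ (braxQ (x ∘ g)) := fun i =>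
    inter_extremePoints_subset_extremePoints_of_subset hFsub
      ⟨subset_convexHull ℝ _ ⟨i, rfl⟩, hext (g i)⟩
  have hFne : (braxQ (x ∘ g)).Nonempty := ⟨_, (hext' 0).1⟩
  have hFd : sdim (braxQ (x ∘ g)) = (d : ℤ) - 1 := hFf.2
  -- listed sets are proper faces
  have hLface : ∀ L ∈ Lm, IsFaceOf (braxQ (x ∘ g)) (convexHull ℝ ((x ∘ g) '' L)) := by
    intro L hL
    obtain ⟨S', hS', rfl⟩ := h1 L hL
    have e : (x ∘ g) '' (g ⁻¹' S') = x '' (Set.range g ∩ S') := by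
      rw [Set.image_comp, Set.image_preimage_eq_range_inter]
    have hf := face_inter hinj hext (hFeq ▸ hFf.1) ((hF _).mpr ⟨S', hS', rfl⟩).1
    rw [e]
    refine ⟨hf.1.mono hFsub ?_, hf.2⟩
    rw [hFeq]
    exact convexHull_mono (Set.image_mono Set.inter_subset_left)
  have hLne : ∀ L ∈ Lm, convexHull ℝ ((x ∘ g) '' L) ≠ braxQ (x ∘ g) := by
    intro L hL he
    apply h0 L hL
    ext i
    simp only [Set.mem_univ, iff_true]
    rw [← hull_mem_iff hinj' hext', he]
    exact (hext' i).1
  have main : ∀ R, IsFacetOf (d - 1) (braxQ (x ∘ g)) R →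
      ∃ L ∈ Lm, R = convexHull ℝ ((x ∘ g) '' L) := by
    intro R hR
    have hRd : sdim R = (d : ℤ) - 2 := by
      have := hR.2
      push_cast [show 1 ≤ d by omega] at this
      linarith
    have hRne : R.Nonempty := by
      by_contra hcon
      rw [sdim, if_neg hcon] at hRd
      omega
    have hRQ : IsFaceOf (braxQ x) R := ⟨hFf.1.1.trans hR.1.1, hR.1.2⟩
    -- a vertex outside
    obtain ⟨k, hk⟩ : ∃ k, x (g k) ∉ R := by
      by_contra! hcon
      have : R = braxQ (x ∘ g) := by
        refine Set.Subset.antisymm hR.1.1.subset (convexHull_min ?_ hR.1.2.1)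
        rintro _ ⟨i, rfl⟩
        exact hcon i
      rw [this, hFd] at hRd
      omega
    obtain ⟨G, hG1, hG2, hG3, hG4⟩ := exists_facet (Set.finite_range x) hRQ hRne
      ⟨g k, rfl⟩ hk
    have hGf : IsFacetOf d (braxQ x) G := ⟨hG1, by rw [hG4]; rw [← hQd]; rfl⟩
    obtain ⟨S', hS', hGS⟩ := (hF G).mp hGf
    obtain ⟨L, hL, hLs⟩ := h2 S' hS' (by
      intro hu
      apply hG3
      rw [hGS, hull_mem_iff hinj hext]
      have : k ∈ g ⁻¹' S' := by rw [hu]; trivial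
      exact this)
    refine ⟨L, hL, ?_⟩
    have hRL : R ⊆ convexHull ℝ ((x ∘ g) '' L) := by
      rw [face_eq_hull (Set.finite_range (x ∘ g)) hR.1]
      apply convexHull_mono
      rintro _ ⟨⟨i, rfl⟩, hi⟩
      refine ⟨i, hLs ?_, rfl⟩
      have := hG2 hi
      rw [hGS] at this
      exact (hull_mem_iff hinj hext S' (g i)).mp this
    by_contra hcon
    have hR' : IsExtreme ℝ (convexHull ℝ ((x ∘ g) '' L)) R :=
      hR.1.1.mono (hLface L hL).1.subset hRL
    have l1 := face_dim_lt (Set.toFinite _) hR' hR.1.2.1 hRne hcon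
    have l2 := face_dim_lt (Set.finite_range (x ∘ g)) (hLface L hL).1 (hLface L hL).2.1
      (hRne.mono hRL) (hLne L hL)
    rw [sdim, if_pos hRne] at hRd
    rw [sdim, if_pos hFne] at hFd
    unfold braxQ at hFd
    omega
  refine ⟨main R, ?_⟩
  rintro ⟨L, hL, rfl⟩
  obtain ⟨k, hk⟩ : ∃ k, k ∉ L := by
    by_contra! hcon
    exact h0 L hL (Set.eq_univ_of_forall hcon)
  obtain ⟨l, hl⟩ := hne L hL
  obtain ⟨G, hG1, hG2, hG3, hG4⟩ := exists_facet (Set.finite_range (x ∘ g)) (hLface L hL)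
    ⟨_, subset_convexHull ℝ _ ⟨l, hl, rfl⟩⟩ ⟨k, rfl⟩
    (fun h => hk ((hull_mem_iff hinj' hext' L k).mp h))
  have hGf : IsFacetOf (d - 1) (braxQ (x ∘ g)) G := by
    refine ⟨hG1, ?_⟩
    unfold braxQ at hFd
    rw [hG4, hFd]
    push_cast [show 1 ≤ d by omega]
    rfl
  obtain ⟨L', hL', rfl⟩ := main G hGf
  have : L = L' := h3 L hL L' hL' fun i hi =>
    (hull_mem_iff hinj' hext' L' i).mp (hG2 (subset_convexHull ℝ _ ⟨i, hi, rfl⟩))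
  rw [this]
  exact hGf

/-! ### Combinatorics of the facets -/

/-- Index set of the facet `T_i`. -/
def Tidx (d n i : ℕ) : Set (Fin (n + 1)) := {k | i ≤ k.val ∧ k.val < i + d}

/-- Index set of the facet `E_j`. -/
def Eidx (d n j : ℕ) : Set (Fin (n + 1)) :=
  {k | k.val = 0 ∨ (j + 2 ≤ k.val + d ∧ k.val + 2 ≤ j + d ∧ (k.val ≠ j ∨ j = n))}

/-- Index sets of all facets. -/
def Fam (d n : ℕ) : Set (Set (Fin (n + 1))) :=
  {S | (∃ i : ℕ, i + d ≤ n + 1 ∧ S = Tidx d n i) ∨ (∃ j : ℕ, 2 ≤ j ∧ j ≤ n ∧ S = Eidx d n j)}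

lemma mem_Tidx {d n i : ℕ} {k : Fin (n + 1)} : k ∈ Tidx d n i ↔ i ≤ k.val ∧ k.val < i + d :=
  Iff.rfl

lemma mem_Eidx {d n j : ℕ} {k : Fin (n + 1)} : k ∈ Eidx d n j ↔
    k.val = 0 ∨ (j + 2 ≤ k.val + d ∧ k.val + 2 ≤ j + d ∧ (k.val ≠ j ∨ j = n)) :=
  Iff.rfl

lemma Tset_eq {d n : ℕ} (x : Fin (n + 1) → V) {i : ℕ} (hi : i + d ≤ n + 1) :
    Tset d x (i : ℤ) = x '' Tidx d n i := by
  ext y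
  constructor
  · rintro ⟨t, ⟨h1, h2⟩, rfl⟩
    exact ⟨_, ⟨by simp only; omega, by simp only; omega⟩, rfl⟩
  · rintro ⟨k, ⟨h1, h2⟩, rfl⟩
    refine ⟨(k.val : ℤ), ⟨by omega, by omega⟩, ?_⟩
    unfold xc
    congr 1
    ext
    simp only
    omega

lemma Eset_eq {d n : ℕ} (hd : 3 ≤ d) (x : Fin (n + 1) → V) {j : ℕ} (hj : 2 ≤ j) (hjn : j ≤ n) :
    Eset d x (j : ℤ) = x '' Eidx d n j := by
  ext y
  constructor
  · rintro (rfl | ⟨t, ⟨⟨h1, h2⟩, h3⟩, rfl⟩)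
    · exact ⟨0, Or.inl rfl, rfl⟩
    · have h3' : t ≠ (j : ℤ) := h3
      refine ⟨_, ?_, rfl⟩
      rw [mem_Eidx]
      simp only
      omega
  · rintro ⟨k, hk, rfl⟩
    rw [mem_Eidx] at hk
    have hkn := k.isLt
    by_cases h0 : k.val = 0
    · left
      congr 1
      ext
      simpa using h0
    · right
      by_cases hkj : k.val = j
      · refine ⟨(n : ℤ) + 1, ⟨⟨by omega, by omega⟩, ?_⟩, ?_⟩
        · intro h
          have h' : (n : ℤ) + 1 = j := h
          omega
        · unfold xc
          congr 1
          ext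
          simp only
          omega
      · refine ⟨(k.val : ℤ), ⟨⟨by omega, by omega⟩, ?_⟩, ?_⟩
        · intro h
          have h' : (k.val : ℤ) = j := h
          omega
        · unfold xc
          congr 1
          ext
          simp only
          omega

lemma fam_iff {d n : ℕ} (hd : 3 ≤ d) (hn : d ≤ n) (x : Fin (n + 1) → V) (F : Set V) :
    ((∃ i : ℤ, 0 ≤ i ∧ i ≤ (n : ℤ) - d + 1 ∧ F = convexHull ℝ (Tset d x i)) ∨
      (∃ j : ℤ, 2 ≤ j ∧ j ≤ (n : ℤ) ∧ F = convexHull ℝ (Eset d x j))) ↔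
    ∃ S ∈ Fam d n, F = convexHull ℝ (x '' S) := by
  constructor
  · rintro (⟨i, h1, h2, rfl⟩ | ⟨j, h1, h2, rfl⟩)
    · lift i to ℕ using h1
      exact ⟨_, Or.inl ⟨i, by omega, rfl⟩, by rw [Tset_eq x (by omega)]⟩
    · lift j to ℕ using (by omega)
      exact ⟨_, Or.inr ⟨j, by omega, by omega, rfl⟩, by
        rw [Eset_eq hd x (by omega) (by omega)]⟩
  · rintro ⟨_, ⟨i, h1, rfl⟩ | ⟨j, h1, h2, rfl⟩, rfl⟩
    · exact Or.inl ⟨i, by omega, by omega, by rw [Tset_eq x h1]⟩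
    · exact Or.inr ⟨j, by omega, by omega, by rw [Eset_eq hd x h1 h2]⟩

lemma fam_nonempty {d n : ℕ} (hd : 3 ≤ d) {L : Set (Fin (n + 1))}
    (hL : L ∈ Fam d n) : L.Nonempty := by
  rcases hL with ⟨i, h1, rfl⟩ | ⟨j, h1, h2, rfl⟩
  · exact ⟨⟨i, by omega⟩, by rw [mem_Tidx]; simp only; omega⟩
  · exact ⟨0, Or.inl rfl⟩

lemma fam_ne_univ {d n : ℕ} (hd : 3 ≤ d) (hn : d ≤ n) {L : Set (Fin (n + 1))}
    (hL : L ∈ Fam d n) : L ≠ Set.univ := by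
  intro hu
  have hall : ∀ k, k ∈ L := fun k => by rw [hu]; trivial
  rcases hL with ⟨i, h1, rfl⟩ | ⟨j, h1, h2, rfl⟩
  · have a := hall ⟨0, by omega⟩
    have b := hall ⟨n, by omega⟩
    rw [mem_Tidx] at a b
    simp only at a b
    omega
  · have a := hall ⟨j, by omega⟩
    have b := hall ⟨1, by omega⟩
    rw [mem_Eidx] at a b
    simp only at a b
    omega

lemma fam_antichain {d n : ℕ} (hd : 3 ≤ d) (hn : d ≤ n) {L L' : Set (Fin (n + 1))}
    (hL : L ∈ Fam d n) (hL' : L' ∈ Fam d n) (h : L ⊆ L') : L = L' := by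
  have hw : ∀ (k : ℕ) (hk : k < n + 1), (⟨k, hk⟩ : Fin (n + 1)) ∈ L →
    (⟨k, hk⟩ : Fin (n + 1)) ∈ L' := fun k hk hm => h hm
  rcases hL with ⟨i, h1, rfl⟩ | ⟨j, h1, h2, rfl⟩ <;>
  rcases hL' with ⟨i', h1', rfl⟩ | ⟨j', h1', h2', rfl⟩ <;>
  simp only [mem_Tidx, mem_Eidx] at hw
  · have a := hw i (by omega)
    have b := hw (i + d - 1) (by omega)
    have : i = i' := by omega
    rw [this]
  · exfalso
    have a := hw i (by omega)
    have b := hw (i + d - 1) (by omega)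
    have c := hw (i + 1) (by omega)
    by_cases hc : i ≤ j' ∧ j' < i + d
    · have e := hw j' (by omega)
      omega
    · omega
  · exfalso
    have a := hw 0 (by omega)
    have b := hw n (by omega)
    by_cases hj : j = n
    · omega
    · have c := hw (j + 1) (by omega)
      by_cases hd1 : j = d
      · omega
      · have e := hw d (by omega)
        omega
  · have : j = j' := by
      by_contra hne
      have a := hw j' (by omega)
      have b := hw (j - 1) (by omega)
      have b' := hw j (by omega)
      have e := hw n (by omega)
      by_cases hjn : j = n
      · omega
      · have c := hw (j + 1) (by omega)
        by_cases hjd : j + 2 ≤ d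
        · have f := hw 1 (by omega)
          omega
        · have f := hw (j + 2 - d) (by omega)
          omega
    rw [this]

/-- Combinatorial data exhibiting the facet with index set `S` as a lower braxtope. -/
def GoodIdx (d n : ℕ) (S : Set (Fin (n + 1))) : Prop :=
  ∃ (m : ℕ) (g : Fin (m + 1) → Fin (n + 1)), StrictMono g ∧ Set.range g = S ∧
    (d = 3 → m = 2) ∧
    (4 ≤ d → d - 1 ≤ m ∧ (∀ L ∈ Fam (d - 1) m, ∃ S' ∈ Fam d n, g ⁻¹' S' = L) ∧
      (∀ S' ∈ Fam d n, g ⁻¹' S' ≠ Set.univ → ∃ L ∈ Fam (d - 1) m, g ⁻¹' S' ⊆ L))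

lemma simplex_fam {D : ℕ} (hD : 3 ≤ D) (L : Set (Fin (D + 1))) :
    L ∈ Fam D D ↔ ∃ k : Fin (D + 1), L = {k}ᶜ := by
  constructor
  · rintro (⟨i, h1, rfl⟩ | ⟨j, h1, h2, rfl⟩)
    · refine ⟨⟨if i = 0 then D else 0, by split <;> omega⟩, ?_⟩
      ext t
      have := t.isLt
      rw [mem_Tidx, Set.mem_compl_iff, Set.mem_singleton_iff, Fin.ext_iff]
      simp only
      split <;> omega
    · refine ⟨⟨if j = D then 1 else j, by split <;> omega⟩, ?_⟩
      ext t
      have := t.isLt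
      rw [mem_Eidx, Set.mem_compl_iff, Set.mem_singleton_iff, Fin.ext_iff]
      simp only
      split <;> omega
  · rintro ⟨k, rfl⟩
    have hk := k.isLt
    by_cases h : k.val = 0 ∨ k.val = D
    · left
      refine ⟨if k.val = 0 then 1 else 0, by split <;> omega, ?_⟩
      ext t
      have := t.isLt
      rw [mem_Tidx, Set.mem_compl_iff, Set.mem_singleton_iff, Fin.ext_iff]
      split <;> omega
    · right
      refine ⟨if k.val = 1 then D else k.val, by split <;> omega, by split <;> omega, ?_⟩
      ext t
      have := t.isLt
      rw [mem_Eidx, Set.mem_compl_iff, Set.mem_singleton_iff, Fin.ext_iff]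
      split <;> omega

lemma good_simplex {D n : ℕ} (hD : 2 ≤ D) (g : Fin (D + 1) → Fin (n + 1)) (hg : StrictMono g)
    (h : 3 ≤ D → ∀ k, ∃ S' ∈ Fam (D + 1) n, g ⁻¹' S' = {k}ᶜ) :
    GoodIdx (D + 1) n (Set.range g) := by
  refine ⟨D, g, hg, rfl, by omega, fun hd => ⟨by omega, ?_, ?_⟩⟩
  · intro L hL
    obtain ⟨k, rfl⟩ := (simplex_fam (by omega) L).mp hL
    exact h (by omega) k
  · intro S' _ hne
    obtain ⟨k, hk⟩ : ∃ k, k ∉ g ⁻¹' S' := by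
      by_contra! hcon
      exact hne (Set.eq_univ_of_forall hcon)
    refine ⟨{k}ᶜ, (simplex_fam (by omega) _).mpr ⟨k, rfl⟩, ?_⟩
    intro t ht htk
    exact hk (htk ▸ ht)

lemma good_T {d n i : ℕ} (hd : 3 ≤ d) (hn : d ≤ n) (hi : i + d ≤ n + 1) :
    GoodIdx d n (Tidx d n i) := by
  obtain ⟨D, rfl⟩ : ∃ D, d = D + 1 := ⟨d - 1, by omega⟩
  have hr : Tidx (D + 1) n i =
      Set.range (fun t : Fin (D + 1) => (⟨i + t.val, by omega⟩ : Fin (n + 1))) := by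
    ext k
    rw [mem_Tidx]
    constructor
    · rintro ⟨h1, h2⟩
      exact ⟨⟨k.val - i, by omega⟩, Fin.ext (by simp only; omega)⟩
    · rintro ⟨t, rfl⟩
      simp only
      omega
  rw [hr]
  refine good_simplex (by omega) _ ?_ ?_
  · intro s t hst
    simpa using hst
  · intro hD k
    have hk := k.isLt
    by_cases c1 : k.val = 0
    · by_cases c2 : i + (D + 1) = n + 1
      · refine ⟨Eidx (D + 1) n n, Or.inr ⟨n, by omega, le_rfl, rfl⟩, ?_⟩
        ext t
        have := t.isLt
        rw [Set.mem_preimage, mem_Eidx, Set.mem_compl_iff, Set.mem_singleton_iff, Fin.ext_iff]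
        simp only
        constructor
        · omega
        · intro ht
          exact Or.inr ⟨by omega, by omega, Or.inr trivial⟩
      · refine ⟨Tidx (D + 1) n (i + 1), Or.inl ⟨i + 1, by omega, rfl⟩, ?_⟩
        ext t
        have := t.isLt
        rw [Set.mem_preimage, mem_Tidx, Set.mem_compl_iff, Set.mem_singleton_iff, Fin.ext_iff]
        simp only
        omega
    · by_cases c2 : k.val = D ∧ i ≠ 0
      · refine ⟨Tidx (D + 1) n (i - 1), Or.inl ⟨i - 1, by omega, rfl⟩, ?_⟩
        ext t
        have := t.isLt
        rw [Set.mem_preimage, mem_Tidx, Set.mem_compl_iff, Set.mem_singleton_iff, Fin.ext_iff]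
        simp only
        omega
      · by_cases c3 : i + k.val = 1
        · refine ⟨Eidx (D + 1) n (D + 1), Or.inr ⟨D + 1, by omega, by omega, rfl⟩, ?_⟩
          ext t
          have := t.isLt
          rw [Set.mem_preimage, mem_Eidx, Set.mem_compl_iff, Set.mem_singleton_iff, Fin.ext_iff]
          simp only
          omega
        · refine ⟨Eidx (D + 1) n (i + k.val), Or.inr ⟨i + k.val, by omega, by omega, rfl⟩, ?_⟩
          ext t
          have := t.isLt
          rw [Set.mem_preimage, mem_Eidx, Set.mem_compl_iff, Set.mem_singleton_iff, Fin.ext_iff]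
          simp only
          omega

lemma good_En {d n : ℕ} (hd : 3 ≤ d) (hn : d ≤ n) : GoodIdx d n (Eidx d n n) := by
  obtain ⟨D, rfl⟩ : ∃ D, d = D + 1 := ⟨d - 1, by omega⟩
  obtain ⟨e, rfl⟩ : ∃ e, n = D + 1 + e := ⟨n - (D + 1), by omega⟩
  obtain ⟨g, hgv⟩ : ∃ g : Fin (D + 1) → Fin (D + 1 + e + 1), ∀ t,
      (t.val = 0 ∧ (g t).val = 0) ∨ (1 ≤ t.val ∧ (g t).val = e + 1 + t.val) := by
    refine ⟨fun t => ⟨if t.val = 0 then 0 else e + 1 + t.val, by split <;> omega⟩, fun t => ?_⟩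
    simp only
    split <;> omega
  have hr : Eidx (D + 1) (D + 1 + e) (D + 1 + e) = Set.range g := by
    ext k
    have hk := k.isLt
    rw [mem_Eidx]
    constructor
    · intro h
      refine ⟨⟨k.val - (e + 1), by omega⟩, Fin.ext ?_⟩
      have := hgv ⟨k.val - (e + 1), by omega⟩
      simp only at this
      omega
    · rintro ⟨t, rfl⟩
      have := hgv t
      omega
  rw [hr]
  refine good_simplex (by omega) g ?_ ?_
  · intro s t hst
    have h1 := hgv s
    have h2 := hgv t
    rw [Fin.lt_def] at hst ⊢
    omega
  · intro hD k
    have hk := k.isLt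
    have hgk := hgv k
    by_cases c1 : k.val = 0
    · refine ⟨Tidx (D + 1) _ (e + 1), Or.inl ⟨e + 1, by omega, rfl⟩, ?_⟩
      ext t
      have := hgv t
      have := t.isLt
      rw [Set.mem_preimage, mem_Tidx, Set.mem_compl_iff, Set.mem_singleton_iff, Fin.ext_iff]
      omega
    by_cases c2 : k.val = D
    · by_cases c3 : e = 0
      · refine ⟨Tidx (D + 1) _ 0, Or.inl ⟨0, by omega, rfl⟩, ?_⟩
        ext t
        have := hgv t
        have := t.isLt
        rw [Set.mem_preimage, mem_Tidx, Set.mem_compl_iff, Set.mem_singleton_iff, Fin.ext_iff]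
        omega
      · refine ⟨Eidx (D + 1) _ (e + 1), Or.inr ⟨e + 1, by omega, by omega, rfl⟩, ?_⟩
        ext t
        have := hgv t
        have := t.isLt
        rw [Set.mem_preimage, mem_Eidx, Set.mem_compl_iff, Set.mem_singleton_iff, Fin.ext_iff]
        omega
    · refine ⟨Eidx (D + 1) _ (e + 1 + k.val), Or.inr ⟨e + 1 + k.val, by omega, by omega, rfl⟩, ?_⟩
      ext t
      have := hgv t
      have := t.isLt
      rw [Set.mem_preimage, mem_Eidx, Set.mem_compl_iff, Set.mem_singleton_iff, Fin.ext_iff]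
      omega

lemma good_E {d n j : ℕ} (hd : 3 ≤ d) (hn : d ≤ n) (hj : 2 ≤ j) (hjn : j < n) :
    GoodIdx d n (Eidx d n j) := by
  obtain ⟨a, ha⟩ : ∃ a, (a = 1 ∧ j + 1 ≤ d) ∨ (a + d = j + 2 ∧ 1 ≤ a) := by
    by_cases h : j + 1 ≤ d
    · exact ⟨1, by omega⟩
    · exact ⟨j + 2 - d, by omega⟩
  obtain ⟨m, hm⟩ : ∃ m, (a + m = n ∧ n + 2 ≤ j + d) ∨ (a + m + 2 = j + d ∧ a + m ≤ n) := by
    by_cases h : n + 2 ≤ j + d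
    · exact ⟨n - a, by omega⟩
    · exact ⟨j + d - 2 - a, by omega⟩
  obtain ⟨g, hgv⟩ : ∃ g : Fin (m + 1) → Fin (n + 1), ∀ t,
      (t.val = 0 ∧ (g t).val = 0) ∨ (1 ≤ t.val ∧ a + t.val ≤ j ∧ (g t).val + 1 = a + t.val) ∨
      (j < a + t.val ∧ (g t).val = a + t.val) := by
    refine ⟨fun t => ⟨if t.val = 0 then 0 else if a + t.val ≤ j then a + t.val - 1 else a + t.val,
      by split_ifs <;> omega⟩, fun t => ?_⟩
    simp only
    split_ifs <;> omega
  have haj : a < j := by omega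
  refine ⟨m, g, ?_, ?_, by omega, fun hd4 => ⟨by omega, ?_, ?_⟩⟩
  · intro s t hst
    have h1 := hgv s
    have h2 := hgv t
    rw [Fin.lt_def] at hst ⊢
    omega
  · ext k
    have hk := k.isLt
    rw [mem_Eidx]
    constructor
    · rintro ⟨t, rfl⟩
      have := hgv t
      omega
    · intro h
      by_cases h0 : k.val = 0
      · refine ⟨0, Fin.ext ?_⟩
        have := hgv 0
        simp only [Fin.val_zero] at this
        omega
      by_cases h1 : k.val < j
      · refine ⟨⟨k.val + 1 - a, by omega⟩, Fin.ext ?_⟩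
        have := hgv ⟨k.val + 1 - a, by omega⟩
        simp only at this
        omega
      · refine ⟨⟨k.val - a, by omega⟩, Fin.ext ?_⟩
        have := hgv ⟨k.val - a, by omega⟩
        simp only at this
        omega
  · rintro _ (⟨i, h1, rfl⟩ | ⟨l, h1, h2, rfl⟩)
    · by_cases hi : i = 0
      · by_cases c : a ≤ 2
        · refine ⟨Tidx d n 0, Or.inl ⟨0, by omega, rfl⟩, ?_⟩
          ext t
          have := hgv t
          rw [Set.mem_preimage, mem_Tidx, mem_Tidx]
          omega
        · refine ⟨Eidx d n (a - 1), Or.inr ⟨a - 1, by omega, by omega, rfl⟩, ?_⟩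
          ext t
          have := hgv t
          rw [Set.mem_preimage, mem_Eidx, mem_Tidx]
          omega
      · refine ⟨Tidx d n (a - 1 + i), Or.inl ⟨a - 1 + i, by omega, rfl⟩, ?_⟩
        ext t
        have := hgv t
        rw [Set.mem_preimage, mem_Tidx, mem_Tidx]
        omega
    · by_cases hl : l = m
      · by_cases hb : a + m = n
        · refine ⟨Eidx d n n, Or.inr ⟨n, by omega, le_rfl, rfl⟩, ?_⟩
          ext t
          have := hgv t
          have := t.isLt
          rw [Set.mem_preimage, mem_Eidx, mem_Eidx]
          omega
        · refine ⟨Eidx d n (a + m + 1), Or.inr ⟨a + m + 1, by omega, by omega, rfl⟩, ?_⟩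
          ext t
          have := hgv t
          have := t.isLt
          rw [Set.mem_preimage, mem_Eidx, mem_Eidx]
          omega
      · by_cases hs : a + l ≤ j
        · refine ⟨Eidx d n (a - 1 + l), Or.inr ⟨a - 1 + l, by omega, by omega, rfl⟩, ?_⟩
          ext t
          have := hgv t
          have := t.isLt
          rw [Set.mem_preimage, mem_Eidx, mem_Eidx]
          omega
        · refine ⟨Eidx d n (a + l), Or.inr ⟨a + l, by omega, by omega, rfl⟩, ?_⟩
          ext t
          have := hgv t
          have := t.isLt
          rw [Set.mem_preimage, mem_Eidx, mem_Eidx]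
          omega
  · rintro _ (⟨k, h1, rfl⟩ | ⟨k, h1, h2, rfl⟩) hne
    · by_cases c1 : k < a
      · refine ⟨Tidx (d - 1) m 0, Or.inl ⟨0, by omega, rfl⟩, ?_⟩
        intro t
        have := hgv t
        rw [Set.mem_preimage, mem_Tidx, mem_Tidx]
        omega
      by_cases c2 : k + d ≤ a + m + 1
      · refine ⟨Tidx (d - 1) m (k + 1 - a), Or.inl ⟨k + 1 - a, by omega, rfl⟩, ?_⟩
        intro t
        have := hgv t
        rw [Set.mem_preimage, mem_Tidx, mem_Tidx]
        omega
      · refine ⟨Eidx (d - 1) m m, Or.inr ⟨m, by omega, le_rfl, rfl⟩, ?_⟩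
        intro t
        have := hgv t
        have := t.isLt
        rw [Set.mem_preimage, mem_Tidx, mem_Eidx]
        omega
    · have hkj : k ≠ j := by
        rintro rfl
        apply hne
        refine Set.eq_univ_of_forall fun t => ?_
        have := hgv t
        have := t.isLt
        rw [Set.mem_preimage, mem_Eidx]
        omega
      by_cases c1 : k ≤ a
      · refine ⟨Tidx (d - 1) m 0, Or.inl ⟨0, by omega, rfl⟩, ?_⟩
        intro t
        have := hgv t
        rw [Set.mem_preimage, mem_Eidx, mem_Tidx]
        omega
      by_cases c2 : k < j
      · refine ⟨Eidx (d - 1) m (k + 1 - a), Or.inr ⟨k + 1 - a, by omega, by omega, rfl⟩, ?_⟩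
        intro t
        have := hgv t
        have := t.isLt
        rw [Set.mem_preimage, mem_Eidx, mem_Eidx]
        omega
      by_cases c3 : k < a + m
      · refine ⟨Eidx (d - 1) m (k - a), Or.inr ⟨k - a, by omega, by omega, rfl⟩, ?_⟩
        intro t
        have := hgv t
        have := t.isLt
        rw [Set.mem_preimage, mem_Eidx, mem_Eidx]
        omega
      · refine ⟨Eidx (d - 1) m m, Or.inr ⟨m, by omega, le_rfl, rfl⟩, ?_⟩
        intro t
        have := hgv t
        have := t.isLt
        rw [Set.mem_preimage, mem_Eidx, mem_Eidx]
        omega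

lemma good_all {d n : ℕ} (hd : 3 ≤ d) (hn : d ≤ n) {S : Set (Fin (n + 1))}
    (hS : S ∈ Fam d n) : GoodIdx d n S := by
  rcases hS with ⟨i, h1, rfl⟩ | ⟨j, h1, h2, rfl⟩
  · exact good_T hd hn h1
  · rcases h2.lt_or_eq with h | rfl
    · exact good_E hd hn h1 h
    · exact good_En hd hn

/-- A `d`-braxtope is braxial: every facet is a `(d-1)`-braxtope with the
induced vertex ordering. -/
theorem braxtope_is_braxial (d n : ℕ) (hd : 3 ≤ d) (hn : d ≤ n)
    (x : Fin (n + 1) → V) (hx : IsBraxtope d n x) :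
    ∀ F : Set V, IsFacetOf d (braxQ x) F →
      ∃ (m : ℕ) (g : Fin (m + 1) → Fin (n + 1)), StrictMono g ∧
        F = convexHull ℝ (Set.range (x ∘ g)) ∧
        IsBraxtope (d - 1) m (x ∘ g) := by
  intro F hF
  obtain ⟨-, hinj, hQd, hext, hfac⟩ := hx.2 hd
  have hFm : ∀ F : Set V, IsFacetOf d (braxQ x) F ↔
      ∃ S ∈ Fam d n, F = convexHull ℝ (x '' S) := fun F =>
    (hfac F).trans (fam_iff hd hn x F)
  obtain ⟨S, hS, hFS⟩ := (hFm F).mp hF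
  obtain ⟨m, g, hg, hr, h3, h4⟩ := good_all hd hn hS
  have hFg : F = convexHull ℝ (Set.range (x ∘ g)) := by
    rw [hFS, ← hr, Set.range_comp]
  have hFd : sdim (convexHull ℝ (Set.range (x ∘ g))) = (d : ℤ) - 1 := hFg ▸ hF.2
  have hsub : braxQ (x ∘ g) ⊆ braxQ x := convexHull_mono (Set.range_comp_subset_range g x)
  refine ⟨m, g, hg, hFg, ?_, ?_⟩
  · intro hd2
    obtain rfl : d = 3 := by omega
    obtain rfl := h3 rfl
    refine ⟨rfl, ?_⟩
    rw [affineIndependent_iff_finrank_vectorSpan_eq ℝ (x ∘ g) (n := 2) (by simp)]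
    rw [sdim, if_pos ⟨_, subset_convexHull ℝ _ ⟨0, rfl⟩⟩, affineSpan_convexHull,
      direction_affineSpan] at hFd
    omega
  · intro hd3
    obtain ⟨hm, c1, c2⟩ := h4 (by omega)
    refine ⟨hm, hinj.comp hg.injective, ?_, ?_, ?_⟩
    · rw [braxQ, hFd]
      omega
    · intro i
      exact inter_extremePoints_subset_extremePoints_of_subset hsub
        ⟨subset_convexHull ℝ _ ⟨i, rfl⟩, hext (g i)⟩
    · intro R
      rw [fam_iff hd3 hm]
      exact key hinj hext (by omega) hQd hFm hg.injective (hr ▸ hS)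
        (fun L hL => fam_nonempty hd3 hL) (fun L hL => fam_ne_univ hd3 hm hL) c1 c2
        (fun L hL L' hL' h => fam_antichain hd3 hm hL hL' h) R
end
end

section
/- The vertex figure Q/x_0 of a d-braxtope Q^{d,n} (n ≥ d ≥ 3) at the vertex x_0 is a (d-1)-multiplex with n vertices, with the ordering induced by the vertex array: writing x̄_u for the vertex of Q/x_0 corresponding to the edge [x_0, x_u], the facets of Q/x_0 are [x̄_{i-d+2}, ..., x̄_{i-1}, x̄_{i+1}, ..., x̄_{i+d-2}] for 1 ≤ i ≤ n. -/
open Set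

noncomputable section

variable {V : Type*} [NormedAddCommGroup V] [NormedSpace ℝ V]

/-- Vertex set of the multiplex facet
`M_i = [y_{i-d+1}, …, y_{i-1}, y_{i+1}, …, y_{i+d-1}]`. -/
def Mset (d : ℕ) {m : ℕ} (y : Fin (m + 1) → V) (i : ℤ) : Set V :=
  xc y '' (Set.Icc (i - (d : ℤ) + 1) (i + (d : ℤ) - 1) \ {i})

/-- `y_0 < ⋯ < y_m` is the vertex array of a `d`-multiplex: a `d`-polytope
whose facets are exactly the `M_i` for `0 ≤ i ≤ m`. -/
def IsMultiplex (d m : ℕ) (y : Fin (m + 1) → V) : Prop :=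
  d ≤ m ∧ Function.Injective y ∧
  sdim (braxQ y) = d ∧
  (∀ i, y i ∈ Set.extremePoints ℝ (braxQ y)) ∧
  (∀ F : Set V, IsFacetOf d (braxQ y) F ↔
    ∃ i : ℤ, 0 ≤ i ∧ i ≤ (m : ℤ) ∧ F = convexHull ℝ (Mset d y i))


/-! ### General facts about convex hulls of finite families -/

theorem bx_mem_hull {ι : Type*} [Fintype ι] (y : ι → V) (S : Set ι) (z : V) :
    z ∈ convexHull ℝ (y '' S) ↔ ∃ v : ι → ℝ, (∀ u, 0 ≤ v u) ∧ (∀ u, u ∉ S → v u = 0) ∧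
      ∑ u, v u = 1 ∧ z = ∑ u, v u • y u := by
  classical
  constructor
  · intro hz
    have hsub : convexHull ℝ (y '' S) ⊆ {z | ∃ v : ι → ℝ, (∀ u, 0 ≤ v u) ∧
        (∀ u, u ∉ S → v u = 0) ∧ ∑ u, v u = 1 ∧ z = ∑ u, v u • y u} := by
      apply convexHull_min
      · rintro _ ⟨u, hu, rfl⟩
        refine ⟨fun k => if k = u then 1 else 0, ?_, ?_, ?_, ?_⟩
        · intro k; dsimp only; split_ifs <;> norm_num
        · intro k hk
          have : k ≠ u := by rintro rfl; exact hk hu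
          simp [this]
        · simp
        · simp
      · rintro a ⟨v, h1, h2, h3, rfl⟩ b ⟨w, k1, k2, k3, rfl⟩ s t hs ht hst
        refine ⟨fun u => s * v u + t * w u, ?_, ?_, ?_, ?_⟩
        · intro u; have := h1 u; have := k1 u; positivity
        · intro u hu; simp [h2 u hu, k2 u hu]
        · rw [Finset.sum_add_distrib, ← Finset.mul_sum, ← Finset.mul_sum, h3, k3]; linarith
        · simp only [add_smul, mul_smul, Finset.sum_add_distrib, Finset.smul_sum]
    exact hsub hz
  · rintro ⟨v, h1, h2, h3, rfl⟩
    have hS : ∑ u, v u • y u = ∑ u ∈ Finset.univ.filter (· ∈ S), v u • y u := by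
      rw [Finset.sum_filter]
      refine Finset.sum_congr rfl fun u _ => ?_
      split_ifs with h
      · rfl
      · simp [h2 u h]
    have hS' : ∑ u, v u = ∑ u ∈ Finset.univ.filter (· ∈ S), v u := by
      rw [Finset.sum_filter]
      refine Finset.sum_congr rfl fun u _ => ?_
      split_ifs with h
      · rfl
      · simp [h2 u h]
    rw [hS]
    refine (convex_convexHull ℝ _).sum_mem (fun u _ => h1 u) (hS' ▸ h3) ?_
    intro u hu
    exact subset_convexHull ℝ _ ⟨u, by simpa using hu, rfl⟩

theorem bx_mem_cone {ι : Type*} [Fintype ι] (p : V) (X : ι → V) (S : Set ι) (z : V) :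
    z ∈ convexHull ℝ (insert p (X '' S)) ↔ ∃ w : ι → ℝ, (∀ u, 0 ≤ w u) ∧
      (∀ u, u ∉ S → w u = 0) ∧ ∑ u, w u ≤ 1 ∧ z = p + ∑ u, w u • (X u - p) := by
  classical
  have hset : insert p (X '' S) =
      (fun o : Option ι => o.elim p X) '' (insert none (some '' S)) := by
    rw [image_insert_eq, image_image]; rfl
  rw [hset, bx_mem_hull]
  constructor
  · rintro ⟨v, h1, h2, h3, rfl⟩
    rw [Fintype.sum_option] at h3
    refine ⟨fun u => v (some u), fun u => h1 _, fun u hu => h2 _ (by simpa using hu), ?_, ?_⟩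
    · have := h1 none; linarith
    · rw [Fintype.sum_option]
      have : v none = 1 - ∑ u, v (some u) := by linarith
      simp only [Option.elim, this, smul_sub, Finset.sum_sub_distrib, ← Finset.sum_smul, sub_smul,
        one_smul]
      abel
  · rintro ⟨w, h1, h2, h3, rfl⟩
    refine ⟨fun o => o.elim (1 - ∑ u, w u) w, ?_, ?_, ?_, ?_⟩
    · rintro (_ | u)
      · simpa using h3
      · exact h1 u
    · rintro (_ | u) hu
      · simp at hu
      · exact h2 u (by simpa using hu)
    · rw [Fintype.sum_option]; simp
    · rw [Fintype.sum_option]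
      simp only [Option.elim, smul_sub, Finset.sum_sub_distrib, ← Finset.sum_smul, sub_smul,
        one_smul]
      abel

/-- Points with positive weight of a convex combination lying in an extreme set are
in the extreme set. -/
theorem bx_extreme_weight {ι : Type*} [Fintype ι] {A F : Set V} (hA : Convex ℝ A)
    (hF : IsExtreme ℝ A F) (y : ι → V) (hy : ∀ u, y u ∈ A) (v : ι → ℝ) (h1 : ∀ u, 0 ≤ v u)
    (h3 : ∑ u, v u = 1) (hz : ∑ u, v u • y u ∈ F) (k : ι) (hk : 0 < v k) : y k ∈ F := by
  classical
  have e1 := Finset.add_sum_erase Finset.univ v (Finset.mem_univ k)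
  have e2 := Finset.add_sum_erase Finset.univ (fun u => v u • y u) (Finset.mem_univ k)
  set R := ∑ u ∈ Finset.univ.erase k, v u with hR
  have hR0 : 0 ≤ R := Finset.sum_nonneg fun u _ => h1 u
  rcases hR0.eq_or_lt with h | h
  · have hz0 : ∀ u ∈ Finset.univ.erase k, v u = 0 :=
      (Finset.sum_eq_zero_iff_of_nonneg fun u _ => h1 u).1 (hR ▸ h.symm)
    have : ∑ u ∈ Finset.univ.erase k, v u • y u = 0 :=
      Finset.sum_eq_zero fun u hu => by rw [hz0 u hu, zero_smul]
    have hk1 : v k = 1 := by linarith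
    rw [← e2, this, hk1, one_smul, add_zero] at hz
    exact hz
  · have hq : ∑ u ∈ Finset.univ.erase k, (R⁻¹ * v u) • y u ∈ A := by
      refine hA.sum_mem (fun u _ => ?_) ?_ (fun u _ => hy u)
      · have := h1 u; positivity
      · rw [← Finset.mul_sum, ← hR]; field_simp
    refine hF.left_mem_of_mem_openSegment (hy k) hq hz ⟨v k, R, hk, h, by linarith, ?_⟩
    rw [← e2, Finset.smul_sum]
    congr 1
    refine Finset.sum_congr rfl fun u _ => ?_
    rw [smul_smul, ← mul_assoc, mul_inv_cancel₀ h.ne', one_mul]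

theorem bx_extreme_eq_hull {ι : Type*} [Fintype ι] (y : ι → V) {F : Set V}
    (hF : IsExtreme ℝ (convexHull ℝ (range y)) F) (hFc : Convex ℝ F) :
    F = convexHull ℝ (y '' {u | y u ∈ F}) := by
  apply Subset.antisymm
  · intro z hz
    have hz' := hF.subset hz
    rw [← image_univ, bx_mem_hull] at hz'
    obtain ⟨v, h1, -, h3, rfl⟩ := hz'
    rw [bx_mem_hull]
    refine ⟨v, h1, ?_, h3, rfl⟩
    intro u hu
    by_contra hne
    exact hu (bx_extreme_weight (convex_convexHull ℝ _) hF y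
      (fun u => subset_convexHull ℝ _ (mem_range_self u)) v h1 h3 hz u
      (lt_of_le_of_ne (h1 u) (Ne.symm hne)))
  · apply convexHull_min _ hFc
    rintro _ ⟨u, hu, rfl⟩
    exact hu

/-! ### The vertex figure of a cone -/

/-- The scaling factor. -/
def bxt (p : V) (f : V →ᵃ[ℝ] ℝ) (c : ℝ) (q : V) : ℝ := (c - f p) / (f q - f p)

/-- The point of the line `p q` with `f = c`. -/
def bxy (p : V) (f : V →ᵃ[ℝ] ℝ) (c : ℝ) (q : V) : V := p + bxt p f c q • (q - p)

theorem bx_f_comb {ι : Type*} [Fintype ι] (p : V) (f : V →ᵃ[ℝ] ℝ) (X : ι → V) (w : ι → ℝ) :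
    f (p + ∑ u, w u • (X u - p)) = f p + ∑ u, w u * (f (X u) - f p) := by
  have h := f.map_vadd p (∑ u, w u • (X u - p))
  simp only [vadd_eq_add] at h
  rw [add_comm p, h, map_sum, add_comm]
  congr 1
  refine Finset.sum_congr rfl fun u _ => ?_
  rw [map_smul, smul_eq_mul]
  congr 1
  have := f.linearMap_vsub (X u) p
  simpa using this

theorem bxt_pos {p q : V} {f : V →ᵃ[ℝ] ℝ} {c : ℝ} (h0 : f p < c) (h1 : c < f q) :
    0 < bxt p f c q := div_pos (by linarith) (by linarith)

theorem bxt_lt {p q : V} {f : V →ᵃ[ℝ] ℝ} {c : ℝ} (h0 : f p < c) (h1 : c < f q) :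
    bxt p f c q < 1 := by
  unfold bxt
  rw [div_lt_one (by linarith)]
  linarith

theorem bxy_openSegment {p q : V} {f : V →ᵃ[ℝ] ℝ} {c : ℝ} (h0 : f p < c) (h1 : c < f q) :
    bxy p f c q ∈ openSegment ℝ p q := by
  have a := bxt_pos h0 h1
  have b := bxt_lt h0 h1
  refine ⟨1 - bxt p f c q, bxt p f c q, by linarith, a, by ring, ?_⟩
  unfold bxy
  rw [smul_sub, sub_smul, one_smul]
  abel

theorem bxy_f {p q : V} {f : V →ᵃ[ℝ] ℝ} {c : ℝ} (h0 : f p < c) (h1 : c < f q) :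
    f (bxy p f c q) = c := by
  have h := bx_f_comb p f (fun _ : Unit => q) (fun _ => bxt p f c q)
  simp only [Finset.univ_unique, Finset.sum_singleton] at h
  have h' : f q - f p ≠ 0 := by linarith
  unfold bxy
  rw [h]
  unfold bxt
  field_simp
  ring

/-- a cone combination rescaled to the section. -/
theorem bx_rescale {ι : Type*} [Fintype ι] {p : V} {f : V →ᵃ[ℝ] ℝ} {c : ℝ} {X : ι → V}
    (h0 : f p < c) (h1 : ∀ u, c < f (X u)) (w : ι → ℝ) (r : ℝ)
    (hr : r * ∑ u, w u * (f (X u) - f p) = c - f p) :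
    ∑ u, r * w u / bxt p f c (X u) = 1 ∧
    ∑ u, (r * w u / bxt p f c (X u)) • bxy p f c (X u) = p + r • ∑ u, w u • (X u - p) := by
  have hc : c - f p ≠ 0 := by linarith
  have hs : ∑ u, r * w u / bxt p f c (X u) = 1 := by
    have : ∀ u, r * w u / bxt p f c (X u) = (r * (w u * (f (X u) - f p))) / (c - f p) := by
      intro u
      have : f (X u) - f p ≠ 0 := by linarith [h1 u]
      unfold bxt
      field_simp
    simp only [this]
    rw [← Finset.sum_div, ← Finset.mul_sum, hr, div_self hc]
  refine ⟨hs, ?_⟩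
  simp only [bxy, smul_add, Finset.sum_add_distrib]
  rw [← Finset.sum_smul, hs, one_smul, Finset.smul_sum]
  congr 1
  refine Finset.sum_congr rfl fun u _ => ?_
  rw [smul_smul, smul_smul]
  congr 1
  have := (bxt_pos h0 (h1 u)).ne'
  field_simp

theorem bx_section {ι : Type*} [Fintype ι] {p : V} {f : V →ᵃ[ℝ] ℝ} {c : ℝ} {X : ι → V}
    (h0 : f p < c) (h1 : ∀ u, c < f (X u)) (S : Set ι) :
    convexHull ℝ (insert p (X '' S)) ∩ {z | f z = c} =
      convexHull ℝ ((fun u => bxy p f c (X u)) '' S) := by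
  apply Subset.antisymm
  · rintro z ⟨hz, hfz⟩
    rw [bx_mem_cone] at hz
    obtain ⟨w, a1, a2, -, rfl⟩ := hz
    have hfz' : f (p + ∑ u, w u • (X u - p)) = c := hfz
    rw [bx_f_comb] at hfz'
    obtain ⟨b1, b2⟩ := bx_rescale h0 h1 w 1 (by linarith)
    rw [bx_mem_hull]
    refine ⟨_, ?_, ?_, b1, ?_⟩
    · intro u
      have := bxt_pos h0 (h1 u)
      have := a1 u
      positivity
    · intro u hu; simp [a2 u hu]
    · rw [b2, one_smul]
  · apply convexHull_min
    · rintro _ ⟨u, hu, rfl⟩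
      refine ⟨?_, bxy_f h0 (h1 u)⟩
      have hp : p ∈ convexHull ℝ (insert p (X '' S)) := subset_convexHull ℝ _ (mem_insert _ _)
      have hq : X u ∈ convexHull ℝ (insert p (X '' S)) :=
        subset_convexHull ℝ _ (mem_insert_of_mem _ ⟨u, hu, rfl⟩)
      exact (convex_convexHull ℝ _).openSegment_subset hp hq (bxy_openSegment h0 (h1 u))
    · refine (convex_convexHull ℝ _).inter ?_
      exact (convex_singleton c).affine_preimage f

theorem bx_cone_extreme {ι : Type*} [Fintype ι] {p : V} {f : V →ᵃ[ℝ] ℝ} {c : ℝ} {X : ι → V}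
    (h0 : f p < c) (h1 : ∀ u, c < f (X u)) {F : Set V}
    (hF : IsExtreme ℝ (convexHull ℝ (range fun u => bxy p f c (X u))) F) (hFc : Convex ℝ F) :
    IsExtreme ℝ (convexHull ℝ (insert p (range X)))
      (convexHull ℝ (insert p (X '' {u | bxy p f c (X u) ∈ F}))) := by
  refine ⟨convexHull_mono (insert_subset_insert (image_subset_range _ _)), ?_⟩
  intro a ha b hb z hz hab
  rw [← image_univ, bx_mem_cone] at ha hb
  rw [bx_mem_cone] at hz
  obtain ⟨α, a1, -, a3, rfl⟩ := ha
  obtain ⟨β, b1, -, b3, rfl⟩ := hb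
  obtain ⟨w, w1, w2, w3, rfl⟩ := hz
  obtain ⟨s, t, hs, ht, hst, hz⟩ := hab
  set γ : ι → ℝ := fun u => s * α u + t * β u with hγ
  have g1 : ∀ u, 0 ≤ γ u := fun u => by
    have := a1 u; have := b1 u; simp only [hγ]; positivity
  have hz' : p + ∑ u, w u • (X u - p) = p + ∑ u, γ u • (X u - p) := by
    rw [← hz]
    simp only [hγ, add_smul, mul_smul, Finset.sum_add_distrib, smul_add, Finset.smul_sum]
    have : s • p + t • p = p := by rw [← add_smul, hst, one_smul]
    rw [add_add_add_comm, this]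
  have hf1 := bx_f_comb p f X w
  have hf2 := bx_f_comb p f X γ
  rw [hz', hf2] at hf1
  have hκ : ∑ u, γ u * (f (X u) - f p) = ∑ u, w u * (f (X u) - f p) := by linarith
  have hpos : ∀ u, 0 < f (X u) - f p := fun u => by linarith [h1 u]
  rw [bx_mem_cone]
  refine ⟨α, a1, ?_, a3, rfl⟩
  intro k hk
  by_contra hne
  have hαk : 0 < α k := lt_of_le_of_ne (a1 k) (Ne.symm hne)
  have hγk : 0 < γ k := by
    have := b1 k; simp only [hγ]; positivity
  have hκpos : 0 < ∑ u, γ u * (f (X u) - f p) :=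
    Finset.sum_pos' (fun u _ => mul_nonneg (g1 u) (hpos u).le)
      ⟨k, Finset.mem_univ _, mul_pos hγk (hpos k)⟩
  set r := (c - f p) / ∑ u, γ u * (f (X u) - f p) with hr
  have hr0 : 0 < r := div_pos (by linarith) hκpos
  have hrκ : r * ∑ u, γ u * (f (X u) - f p) = c - f p := div_mul_cancel₀ _ hκpos.ne'
  obtain ⟨c1, c2⟩ := bx_rescale h0 h1 γ r hrκ
  obtain ⟨d1, d2⟩ := bx_rescale h0 h1 w r (hκ ▸ hrκ)
  have hzz : ∑ u, w u • (X u - p) = ∑ u, γ u • (X u - p) := add_left_cancel hz'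
  have hmem : ∑ u, (r * γ u / bxt p f c (X u)) • bxy p f c (X u) ∈ F := by
    rw [c2, ← hzz, ← d2, bx_extreme_eq_hull (fun u => bxy p f c (X u)) hF hFc, bx_mem_hull]
    refine ⟨_, ?_, ?_, d1, rfl⟩
    · intro u
      have := bxt_pos h0 (h1 u); have := w1 u
      positivity
    · intro u hu
      simp [w2 u hu]
  refine hk (bx_extreme_weight (convex_convexHull ℝ _) hF (fun u => bxy p f c (X u))
    (fun u => subset_convexHull ℝ _ (mem_range_self u)) _ ?_ c1 hmem k ?_)
  · intro u
    have := bxt_pos h0 (h1 u); have := g1 u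
    positivity
  · have := bxt_pos h0 (h1 k)
    positivity

theorem bx_extreme_section {Q G : Set V} (h : IsExtreme ℝ Q G) (H : Set V) :
    IsExtreme ℝ (Q ∩ H) (G ∩ H) :=
  ⟨inter_subset_inter_left _ h.subset, fun _ ha _ hb _ hz hab =>
    ⟨h.left_mem_of_mem_openSegment ha.1 hb.1 hz.1 hab, ha.2⟩⟩

theorem bx_sdim_hull (s : Set V) : sdim (convexHull ℝ s) = sdim s := by
  unfold sdim
  rw [affineSpan_convexHull]
  by_cases h : s.Nonempty
  · rw [if_pos h, if_pos (convexHull_nonempty_iff.2 h)]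
  · rw [if_neg h, if_neg (fun h' => h (convexHull_nonempty_iff.1 h'))]

theorem bx_sdim_cone {ι : Type*} [Fintype ι] {p : V} {f : V →ᵃ[ℝ] ℝ} {c : ℝ} {X : ι → V}
    (h0 : f p < c) (h1 : ∀ u, c < f (X u)) (S : Set ι) :
    sdim (insert p (X '' S)) = sdim ((fun u => bxy p f c (X u)) '' S) + 1 := by
  rcases S.eq_empty_or_nonempty with rfl | ⟨k, hk⟩
  · simp [sdim, direction_affineSpan]
  · set Y := (fun u => bxy p f c (X u)) '' S with hY
    have hYne : Y.Nonempty := ⟨_, k, hk, rfl⟩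
    have hspan : affineSpan ℝ (insert p (X '' S)) = affineSpan ℝ (insert p Y) := by
      apply le_antisymm
      · rw [affineSpan_le]
        have hp : p ∈ affineSpan ℝ (insert p Y) := subset_affineSpan ℝ _ (mem_insert _ _)
        rintro _ (rfl | ⟨u, hu, rfl⟩)
        · exact hp
        · have hq : bxy p f c (X u) ∈ affineSpan ℝ (insert p Y) :=
            subset_affineSpan ℝ _ (mem_insert_of_mem _ ⟨u, hu, rfl⟩)
          have := AffineMap.lineMap_mem (bxt p f c (X u))⁻¹ hp hq
          convert! this using 1
          rw [AffineMap.lineMap_apply, bxy]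
          simp [smul_smul, inv_mul_cancel₀ (bxt_pos h0 (h1 u)).ne']
      · rw [affineSpan_le]
        have hp : p ∈ affineSpan ℝ (insert p (X '' S)) := subset_affineSpan ℝ _ (mem_insert _ _)
        rintro _ (rfl | ⟨u, hu, rfl⟩)
        · exact hp
        · have hq : X u ∈ affineSpan ℝ (insert p (X '' S)) :=
            subset_affineSpan ℝ _ (mem_insert_of_mem _ ⟨u, hu, rfl⟩)
          have := AffineMap.lineMap_mem (bxt p f c (X u)) hp hq
          convert! this using 1
          rw [AffineMap.lineMap_apply]
          simp [bxy, add_comm]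
    have hY0 : bxy p f c (X k) ∈ affineSpan ℝ Y := subset_affineSpan ℝ _ ⟨k, hk, rfl⟩
    have hdir : (affineSpan ℝ (insert p (X '' S))).direction =
        Submodule.span ℝ {p - bxy p f c (X k)} ⊔ (affineSpan ℝ Y).direction := by
      rw [hspan, ← affineSpan_insert_affineSpan, AffineSubspace.direction_affineSpan_insert hY0]
      rfl
    have hker : (affineSpan ℝ Y).direction ≤ LinearMap.ker f.linear := by
      rw [direction_affineSpan, vectorSpan, Submodule.span_le]
      rintro _ ⟨_, ⟨a, ha, rfl⟩, _, ⟨b, hb, rfl⟩, rfl⟩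
      simp only [SetLike.mem_coe, LinearMap.mem_ker, AffineMap.linearMap_vsub]
      simp [bxy_f h0 (h1 _)]
    have hfv : f.linear (p - bxy p f c (X k)) ≠ 0 := by
      have := f.linearMap_vsub p (bxy p f c (X k))
      simp only [vsub_eq_sub, bxy_f h0 (h1 k)] at this
      rw [this]
      linarith
    have hv0 : p - bxy p f c (X k) ≠ 0 := fun h => hfv (by rw [h, map_zero])
    have hYfin : Y.Finite := S.toFinite.image _
    have : FiniteDimensional ℝ (affineSpan ℝ Y).direction := by
      rw [direction_affineSpan]
      exact finiteDimensional_vectorSpan_of_finite ℝ hYfin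
    have hdisj : Submodule.span ℝ {p - bxy p f c (X k)} ⊓ (affineSpan ℝ Y).direction = ⊥ := by
      rw [eq_bot_iff]
      rintro z ⟨hz1, hz2⟩
      obtain ⟨a, rfl⟩ := Submodule.mem_span_singleton.1 hz1
      have := hker hz2
      rw [LinearMap.mem_ker, map_smul, smul_eq_mul] at this
      rcases mul_eq_zero.1 this with h | h
      · simp [h]
      · exact absurd h hfv
    have hfr := Submodule.finrank_sup_add_finrank_inf_eq
      (Submodule.span ℝ {p - bxy p f c (X k)}) (affineSpan ℝ Y).direction
    rw [hdisj, finrank_bot, finrank_span_singleton hv0, ← hdir] at hfr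
    unfold sdim
    rw [if_pos (insert_nonempty _ _), if_pos hYne]
    omega

/-! ### Index combinatorics -/

/-- Index set of the `i`-th facet of the vertex figure. -/
def bxS (d m : ℕ) (i : ℤ) : Set (Fin (m + 1)) :=
  {u | (((u : ℕ) : ℤ) ≠ i ∧ i - ((d : ℤ) - 2) ≤ ((u : ℕ) : ℤ) ∧
      ((u : ℕ) : ℤ) ≤ i + ((d : ℤ) - 2)) ∨
    (((u : ℕ) : ℤ) = 0 ∧ i = 0) ∨ (((u : ℕ) : ℤ) = m ∧ i = m)}

/-- Clamped index. -/
def bxcl (n : ℕ) (t : ℤ) : Fin (n + 1) := ⟨(min (max t 0) n).toNat, by omega⟩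

theorem bxcl_val (n : ℕ) (t : ℤ) : ((bxcl n t : ℕ) : ℤ) = min (max t 0) n := by
  simp only [bxcl]; omega

theorem bx_xc {n : ℕ} (x : Fin (n + 1) → V) : xc x = fun t => x (bxcl n t) := rfl

theorem bx_Mset {d m : ℕ} (hd : 3 ≤ d) (y : Fin (m + 1) → V) {i : ℤ} (hi0 : 0 ≤ i)
    (him : i ≤ m) : Mset (d - 1) y i = y '' bxS d m i := by
  rw [Mset, bx_xc, ← image_image y]
  congr 1
  ext u
  have hu := u.isLt
  simp only [mem_image, mem_sdiff, mem_Icc, mem_singleton_iff, Fin.ext_iff, bxS, mem_ofPred_eq]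
  constructor
  · rintro ⟨t, ht, h⟩
    have := bxcl_val m t
    omega
  · rintro (h | h | h)
    · refine ⟨u, by omega, ?_⟩
      have := bxcl_val m u
      omega
    · refine ⟨-1, by omega, ?_⟩
      have := bxcl_val m (-1)
      omega
    · refine ⟨m + 1, by omega, ?_⟩
      have := bxcl_val m (m + 1)
      omega

theorem bx_Eset {d m : ℕ} (hd : 3 ≤ d) (x : Fin (m + 1 + 1) → V) {i : ℤ} (hi0 : 1 ≤ i)
    (him : i ≤ m) : Eset d x (i + 1) = insert (x 0) ((fun u => x (Fin.succ u)) '' bxS d m i) := by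
  rw [Eset, bx_xc, ← image_image x (bxcl (m + 1)), ← image_image x Fin.succ, ← image_insert_eq, ← image_insert_eq]
  congr 1
  ext u
  have hu := u.isLt
  simp only [mem_insert_iff, mem_image, mem_sdiff, mem_Icc, mem_singleton_iff, Fin.ext_iff, bxS,
    mem_ofPred_eq, Fin.val_zero, Fin.val_succ]
  constructor
  · rintro (h | ⟨t, ht, h⟩)
    · exact Or.inl h
    · have := bxcl_val (m + 1) t
      by_cases h0 : (u : ℕ) = 0
      · exact Or.inl h0
      · refine Or.inr ⟨⟨(u : ℕ) - 1, by omega⟩, ?_, ?_⟩ <;> dsimp only <;> omega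
  · rintro (h | ⟨k, hk, h⟩)
    · exact Or.inl h
    · right
      rcases hk with hk | hk | hk
      · refine ⟨u, by omega, ?_⟩
        have := bxcl_val (m + 1) u
        omega
      · omega
      · refine ⟨m + 2, by omega, ?_⟩
        have := bxcl_val (m + 1) (m + 2)
        omega

theorem bx_Tset {d m : ℕ} (hd : 3 ≤ d) (hdm : d ≤ m + 1) (x : Fin (m + 1 + 1) → V) :
    Tset d x 0 = insert (x 0) ((fun u => x (Fin.succ u)) '' bxS d m 0) := by
  rw [Tset, bx_xc, ← image_image x (bxcl (m + 1)), ← image_image x Fin.succ, ← image_insert_eq]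
  congr 1
  ext u
  have hu := u.isLt
  simp only [mem_insert_iff, mem_image, mem_Icc, Fin.ext_iff, bxS,
    mem_ofPred_eq, Fin.val_zero, Fin.val_succ]
  constructor
  · rintro ⟨t, ht, h⟩
    have := bxcl_val (m + 1) t
    by_cases h0 : (u : ℕ) = 0
    · exact Or.inl h0
    · refine Or.inr ⟨⟨(u : ℕ) - 1, by omega⟩, ?_, ?_⟩ <;> dsimp only <;> (try simp only [and_true]) <;> omega
  · intro h
    have := bxcl_val (m + 1) u
    refine ⟨u, ?_, by omega⟩
    rcases h with h | ⟨k, hk, h⟩ <;> omega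

theorem bx_separate {d m : ℕ} (hd : 3 ≤ d) (hdm : d ≤ m + 1) (u v : Fin (m + 1)) (huv : u ≠ v) :
    ∃ i : ℤ, 0 ≤ i ∧ i ≤ m ∧ u ∈ bxS d m i ∧ v ∉ bxS d m i := by
  have hu := u.isLt
  have hv := v.isLt
  have huv' : (u : ℕ) ≠ v := fun h => huv (Fin.ext h)
  simp only [bxS, mem_ofPred_eq]
  generalize (u : ℕ) = a at *
  generalize (v : ℕ) = b at *
  by_cases hb0 : b = 0
  · by_cases h1 : a + 1 < d
    · exact ⟨d - 1, by omega⟩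
    · by_cases h2 : d ≤ a
      · exact ⟨a - 1, by omega⟩
      · by_cases h3 : a < m
        · exact ⟨d, by omega⟩
        · exact ⟨m, by omega⟩
  · by_cases hbm : b = m
    · by_cases h1 : a + 2 ≤ d
      · exact ⟨0, by omega⟩
      · by_cases h2 : a + d = m + 1
        · exact ⟨a - 1, by omega⟩
        · by_cases h3 : a + 2 * d ≤ m + 2
          · exact ⟨a + 1, by omega⟩
          · exact ⟨m - d + 1, by omega⟩
    · by_cases h1 : a + d ≤ b + 1
      · by_cases h2 : a = 0
        · exact ⟨0, by omega⟩
        · exact ⟨a - 1, by omega⟩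
      · by_cases h2 : b + d ≤ a + 1
        · by_cases h3 : a = m
          · exact ⟨m, by omega⟩
          · exact ⟨a + 1, by omega⟩
        · exact ⟨b, by omega⟩

theorem bx_x0_notMem {d m : ℕ} {x : Fin (m + 1 + 1) → V} (hinj : Function.Injective x)
    (hext : ∀ i, x i ∈ Set.extremePoints ℝ (braxQ x)) {i : ℤ} (hi : 1 ≤ i) :
    x 0 ∉ convexHull ℝ (Tset d x i) := by
  intro h
  have hsub : convexHull ℝ (Tset d x i) ⊆ braxQ x := by
    refine convexHull_mono ?_
    rintro _ ⟨t, -, rfl⟩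
    exact mem_range_self _
  have h2 := extremePoints_convexHull_subset
    (inter_extremePoints_subset_extremePoints_of_subset hsub ⟨h, hext 0⟩)
  obtain ⟨t, ht, h3⟩ := h2
  have h4 := congrArg (fun k : Fin (m + 1 + 1) => (k : ℕ)) (hinj (show x (bxcl _ t) = x 0 from h3))
  have := bxcl_val (m + 1) t
  simp only [mem_Icc, Fin.val_zero] at ht h4
  omega

theorem bx_main (d m : ℕ) (hd : 3 ≤ d) (hn : d ≤ m + 1)
    (x : Fin (m + 1 + 1) → V) (hx : IsBraxtope d (m + 1) x)
    (f : V →ᵃ[ℝ] ℝ) (c : ℝ) (h0 : f (x 0) < c)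
    (hother : ∀ i : Fin (m + 1 + 1), i ≠ 0 → c < f (x i)) :
    ∃ y : Fin (m + 1) → V,
      (∀ u : Fin (m + 1),
        y u ∈ segment ℝ (x 0) (x u.succ) ∧ f (y u) = c) ∧
      braxQ x ∩ {p : V | f p = c} = convexHull ℝ (Set.range y) ∧
      IsMultiplex (d - 1) m y := by
  obtain ⟨-, hinj, hdim, hext, hfac⟩ := hx.2 hd
  set X : Fin (m + 1) → V := fun u => x u.succ with hX
  have h1 : ∀ u, c < f (X u) := fun u => hother _ (Fin.succ_ne_zero u)
  set y : Fin (m + 1) → V := fun u => bxy (x 0) f c (X u) with hy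
  have hQ : braxQ x = convexHull ℝ (insert (x 0) (X '' univ)) := by
    rw [braxQ, image_univ]
    congr 1
    ext z
    simp only [mem_range, mem_insert_iff, Fin.exists_fin_succ, hX, eq_comm]
  have hsec : ∀ S : Set (Fin (m + 1)),
      convexHull ℝ (insert (x 0) (X '' S)) ∩ {z | f z = c} = convexHull ℝ (y '' S) :=
    bx_section h0 h1
  have hsd : ∀ S : Set (Fin (m + 1)),
      sdim (convexHull ℝ (insert (x 0) (X '' S))) = sdim (convexHull ℝ (y '' S)) + 1 := by
    intro S
    rw [bx_sdim_hull, bx_sdim_hull]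
    exact bx_sdim_cone h0 h1 S
  have hP : braxQ x ∩ {p : V | f p = c} = braxQ y := by
    rw [hQ, hsec, image_univ, braxQ]
  -- the facets through `x 0`
  have hfacS : ∀ i : ℤ, 0 ≤ i → i ≤ m →
      IsFacetOf d (braxQ x) (convexHull ℝ (insert (x 0) (X '' bxS d m i))) := by
    intro i hi0 him
    rw [hfac]
    rcases hi0.eq_or_lt with h | h
    · left
      refine ⟨0, le_rfl, by push_cast; omega, ?_⟩
      rw [bx_Tset hd hn, ← h]
    · right
      refine ⟨i + 1, by omega, by push_cast; omega, ?_⟩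
      rw [bx_Eset hd x (by omega) him]
  have hfacS' : ∀ G : Set V, IsFacetOf d (braxQ x) G → x 0 ∈ G →
      ∃ i : ℤ, 0 ≤ i ∧ i ≤ m ∧ G = convexHull ℝ (insert (x 0) (X '' bxS d m i)) := by
    intro G hG hx0
    rcases (hfac G).1 hG with ⟨i, hi0, -, rfl⟩ | ⟨j, hj2, hjn, rfl⟩
    · rcases hi0.eq_or_lt with h | h
      · refine ⟨0, le_rfl, by omega, ?_⟩
        rw [← h, bx_Tset hd hn]
      · exact absurd hx0 (bx_x0_notMem hinj hext (by omega))
    · refine ⟨j - 1, by omega, by push_cast at hjn; omega, ?_⟩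
      rw [← bx_Eset hd x (by omega) (by push_cast at hjn; omega), sub_add_cancel]
  have hPext : ∀ i : ℤ, 0 ≤ i → i ≤ m →
      IsExtreme ℝ (braxQ y) (convexHull ℝ (y '' bxS d m i)) := by
    intro i hi0 him
    rw [← hP, ← hsec]
    exact bx_extreme_section (hfacS i hi0 him).1.1 _
  have hmemS : ∀ i : ℤ, 0 ≤ i → i ≤ m → ∀ k, y k ∈ convexHull ℝ (y '' bxS d m i) →
      k ∈ bxS d m i := by
    intro i hi0 him k hk
    rw [← hsec] at hk
    have hG := (hfacS i hi0 him).1.1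
    have hXk := hG.right_mem_of_mem_openSegment (hext 0).1 (hext k.succ).1 hk.1
      (bxy_openSegment h0 (h1 k))
    have h2 := extremePoints_convexHull_subset
      (inter_extremePoints_subset_extremePoints_of_subset hG.subset ⟨hXk, hext k.succ⟩)
    rcases h2 with h2 | ⟨k', hk', h2⟩
    · exact absurd (hinj h2) (Fin.succ_ne_zero k)
    · have := Fin.succ_injective _ (hinj h2)
      exact this ▸ hk'
  have hymem : ∀ u, y u ∈ braxQ y := fun u => subset_convexHull ℝ _ (mem_range_self u)
  refine ⟨y, fun u => ⟨openSegment_subset_segment _ _ _ (bxy_openSegment h0 (h1 u)),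
    bxy_f h0 (h1 u)⟩, hP, by omega, ?_, ?_, ?_, ?_⟩
  · intro u v huv
    by_contra hne
    obtain ⟨i, hi0, him, hu, hv⟩ := bx_separate hd hn u v hne
    apply hv
    apply hmemS i hi0 him
    rw [← huv]
    exact subset_convexHull ℝ _ ⟨u, hu, rfl⟩
  · have := hsd univ
    rw [← hQ, hdim, image_univ] at this
    have h' : sdim (braxQ y) = sdim (convexHull ℝ (range y)) := rfl
    omega
  · intro u
    refine ⟨hymem u, ?_⟩
    intro a ha b hb hab
    have ha' := ha
    rw [braxQ, ← image_univ, bx_mem_hull] at ha'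
    obtain ⟨v, v1, -, v3, rfl⟩ := ha'
    have hv0 : ∀ k, k ≠ u → v k = 0 := by
      intro k hk
      by_contra hne
      obtain ⟨i, hi0, him, hu, hv⟩ := bx_separate hd hn u k hk.symm
      have hE := hPext i hi0 him
      have haF := hE.left_mem_of_mem_openSegment ha hb
        (subset_convexHull ℝ _ ⟨u, hu, rfl⟩) hab
      exact hv (hmemS i hi0 him k (bx_extreme_weight (convex_convexHull ℝ _) hE y hymem v v1 v3
        haF k (lt_of_le_of_ne (v1 k) (Ne.symm hne))))
    have hvu : v u = 1 := by
      rw [← v3]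
      exact (Finset.sum_eq_single u (fun k _ hk => hv0 k hk) (by simp)).symm
    rw [Finset.sum_eq_single u (fun k _ hk => by rw [hv0 k hk, zero_smul]) (by simp), hvu,
      one_smul]
  · intro F
    constructor
    · rintro ⟨⟨hFe, hFc, -⟩, hFd⟩
      have hG := bx_cone_extreme h0 h1 hFe hFc
      have hFeq := bx_extreme_eq_hull y hFe hFc
      have hGfac : IsFacetOf d (braxQ x)
          (convexHull ℝ (insert (x 0) (X '' {u | bxy (x 0) f c (X u) ∈ F}))) := by
        refine ⟨⟨?_, convex_convexHull ℝ _, ?_⟩, ?_⟩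
        · rw [hQ, image_univ]; exact hG
        · exact (((toFinite _).image X).insert _).isClosed_convexHull (𝕜 := ℝ)
        · rw [hsd]
          change sdim (convexHull ℝ (y '' {u | y u ∈ F})) + 1 = _
          rw [← hFeq, hFd]
          omega
      obtain ⟨i, hi0, him, hGi⟩ := hfacS' _ hGfac (subset_convexHull ℝ _ (mem_insert _ _))
      refine ⟨i, hi0, him, ?_⟩
      rw [bx_Mset hd y hi0 him, ← hsec, ← hGi, hsec]
      exact hFeq
    · rintro ⟨i, hi0, him, rfl⟩
      rw [bx_Mset hd y hi0 him]
      refine ⟨⟨hPext i hi0 him, convex_convexHull ℝ _,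
        ((toFinite _).image y).isClosed_convexHull (𝕜 := ℝ)⟩, ?_⟩
      have e1 := hsd (bxS d m i)
      have e2 := (hfacS i hi0 him).2
      omega

/-- The vertex figure of a `d`-braxtope `Q^{d,n}` at `x_0` is a
`(d-1)`-multiplex with `n` vertices, ordered by the vertex array: cutting `Q`
with any hyperplane `{f = c}` separating `x_0` from the other vertices gives a
`(d-1)`-multiplex whose vertex `x̄_u` lies on the edge `[x_0, x_u]`. -/
theorem braxtope_vertex_figure_multiplex (d n : ℕ) (hd : 3 ≤ d) (hn : d ≤ n)
    (x : Fin (n + 1) → V) (hx : IsBraxtope d n x)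
    (f : V →ᵃ[ℝ] ℝ) (c : ℝ) (h0 : f (x 0) < c)
    (hother : ∀ i : Fin (n + 1), i ≠ 0 → c < f (x i)) :
    ∃ y : Fin (n - 1 + 1) → V,
      (∀ u : Fin (n - 1 + 1),
        y u ∈ segment ℝ (x 0) (x ⟨(u : ℕ) + 1, by have := u.isLt; omega⟩) ∧
          f (y u) = c) ∧
      braxQ x ∩ {p : V | f p = c} = convexHull ℝ (Set.range y) ∧
      IsMultiplex (d - 1) (n - 1) y := by
  obtain ⟨m, rfl⟩ : ∃ m, n = m + 1 := ⟨n - 1, by omega⟩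
  exact bx_main d m hd hn x hx f c h0 hother
end
end

section
/- If d ≥ 3 and d ≤ n ≤ 2d-3, then the d-braxtope Q^{d,n} is a (2d-2-n)-fold pyramid over an (n-d+2)-braxtope, namely over [x_0, x_1, ..., x_{n-d+1}, x_d, ..., x_n] with apices x_{n-d+2}, ..., x_{d-1}. -/
open Set

noncomputable section

variable {V : Type*} [NormedAddCommGroup V] [NormedSpace ℝ V]

/-- `F` is a pyramid over `B` with apex `a`. -/
def IsPyramidOver (Q B : Set V) (a : V) : Prop :=
  Q = convexHull ℝ (insert a B) ∧ a ∉ affineSpan ℝ B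


/-- A linear functional separating `a` from an affine span. -/
theorem brx_exists_functional {S : Set V} {a : V} (hS : S.Nonempty) (ha : a ∉ affineSpan ℝ S) :
    ∃ (f : V →ₗ[ℝ] ℝ) (c : ℝ), (∀ y ∈ affineSpan ℝ S, f y = c) ∧ f a = c + 1 := by
  obtain ⟨p, hp⟩ := hS
  have hp' : p ∈ affineSpan ℝ S := subset_affineSpan ℝ S hp
  have h1 : a - p ∉ (affineSpan ℝ S).direction := by
    intro h
    exact ha ((AffineSubspace.vsub_right_mem_direction_iff_mem hp' a).1 h)
  obtain ⟨f, hf, hker⟩ := Submodule.exists_le_ker_of_notMem h1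
  refine ⟨(f (a - p))⁻¹ • f, (f (a - p))⁻¹ * f p, ?_, ?_⟩
  · intro y hy
    have h2 : y - p ∈ (affineSpan ℝ S).direction :=
      AffineSubspace.vsub_mem_direction hy hp'
    have h3 : f (y - p) = 0 := hker h2
    rw [map_sub, sub_eq_zero] at h3
    simp [h3]
  · have : f a = f (a - p) + f p := by simp
    rw [LinearMap.smul_apply, this, smul_eq_mul, mul_add, inv_mul_cancel₀ hf]
    ring

theorem brx_mem_insert {F : Set V} {a : V} (hF : Convex ℝ F) (hne : F.Nonempty) (y : V) :
    y ∈ convexHull ℝ (insert a F) ↔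
      ∃ t : ℝ, 0 ≤ t ∧ t ≤ 1 ∧ ∃ z ∈ F, y = (1 - t) • a + t • z := by
  rw [convexHull_insert hne, hF.convexHull_eq, mem_convexJoin]
  constructor
  · rintro ⟨_, rfl, z, hz, s, t, hs, ht, hst, rfl⟩
    refine ⟨t, ht, by linarith, z, hz, ?_⟩
    rw [← hst]; simp
  · rintro ⟨t, h0, h1, z, hz, rfl⟩
    exact ⟨a, rfl, z, hz, 1 - t, t, by linarith, h0, by ring, rfl⟩

theorem brx_sub_aff {S F : Set V} (hF : F ⊆ convexHull ℝ S) : F ⊆ affineSpan ℝ S :=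
  hF.trans (convexHull_subset_affineSpan S)

/-- The base of a pyramid recovers a face. -/
theorem brx_inter {S F : Set V} {a : V} (ha : a ∉ affineSpan ℝ S)
    (hF : Convex ℝ F) (hne : F.Nonempty) (hFS : F ⊆ convexHull ℝ S) {y : V}
    (hy : y ∈ convexHull ℝ (insert a F)) (hyS : y ∈ affineSpan ℝ S) : y ∈ F := by
  have hS : S.Nonempty := by
    rw [← convexHull_nonempty_iff (𝕜 := ℝ)]; exact hne.mono hFS
  obtain ⟨f, c, hf, hfa⟩ := brx_exists_functional hS ha
  obtain ⟨t, h0, h1, z, hz, rfl⟩ := (brx_mem_insert hF hne y).1 hy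
  have e1 := hf _ hyS
  have e2 := hf _ (brx_sub_aff hFS hz)
  simp only [map_add, map_smul, smul_eq_mul, hfa, e2] at e1
  have : t = 1 := by linarith
  subst this
  simpa using hz

theorem brx_sdim_insert {F S : Set V} {a : V} (hS : S.Finite) (hFS : F ⊆ convexHull ℝ S)
    (hne : F.Nonempty) (ha : a ∉ affineSpan ℝ F) :
    sdim (convexHull ℝ (insert a F)) = sdim F + 1 := by
  have hfin : FiniteDimensional ℝ (affineSpan ℝ F).direction := by
    have h1 : FiniteDimensional ℝ (affineSpan ℝ S).direction :=
      finiteDimensional_direction_affineSpan_of_finite ℝ hS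
    refine Submodule.finiteDimensional_of_le (AffineSubspace.direction_le ?_)
      (S₂ := (affineSpan ℝ S).direction)
    exact affineSpan_le.2 (brx_sub_aff hFS)
  unfold sdim
  have hne2 : (convexHull ℝ (insert a F)).Nonempty :=
    convexHull_nonempty_iff.2 (insert_nonempty _ _)
  rw [if_pos hne2, if_pos hne, affineSpan_convexHull]
  obtain ⟨p, hp⟩ := hne
  have hp' : p ∈ affineSpan ℝ F := subset_affineSpan ℝ F hp
  have h1 : a - p ∉ (affineSpan ℝ F).direction := fun h =>
    ha ((AffineSubspace.vsub_right_mem_direction_iff_mem hp' a).1 h)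
  have h0 : a - p ≠ 0 := fun h => h1 (h ▸ Submodule.zero_mem _)
  have h2 : (affineSpan ℝ (insert a F)).direction
      = Submodule.span ℝ {a - p} ⊔ (affineSpan ℝ F).direction := by
    rw [← affineSpan_insert_affineSpan, AffineSubspace.direction_affineSpan_insert hp']
    rfl
  rw [h2]
  have h3 := Submodule.finrank_sup_add_finrank_inf_eq (Submodule.span ℝ {a - p})
    (affineSpan ℝ F).direction
  have h4 : Submodule.span ℝ {a - p} ⊓ (affineSpan ℝ F).direction = ⊥ := by
    rw [← disjoint_iff, disjoint_comm, Submodule.disjoint_span_singleton' h0]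
    exact h1
  rw [h4, finrank_bot, finrank_span_singleton h0] at h3
  rw [add_zero] at h3
  rw [h3]; push_cast; ring

theorem brx_step {S F : Set V} {a : V} (hS : S.Finite) (ha : a ∉ affineSpan ℝ S) (d : ℕ)
    (hF : Convex ℝ F) (hne : F.Nonempty) (hFS : F ⊆ convexHull ℝ S) :
    IsFacetOf d (convexHull ℝ S) F ↔
      IsFacetOf (d + 1) (convexHull ℝ (insert a S)) (convexHull ℝ (insert a F)) := by
  have hSne : S.Nonempty := by
    rw [← convexHull_nonempty_iff (𝕜 := ℝ)]; exact hne.mono hFS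
  have hQ : convexHull ℝ (insert a S) = convexHull ℝ (insert a (convexHull ℝ S)) := by
    rw [insert_eq, insert_eq, convexHull_convexHull_union_right]
  have hBne : (convexHull ℝ S).Nonempty := hne.mono hFS
  have haF : a ∉ affineSpan ℝ F := fun h => ha (affineSpan_le.2 (brx_sub_aff hFS) h)
  have hdim := brx_sdim_insert hS hFS hne haF
  unfold IsFacetOf
  rw [hdim]
  have hcast : (sdim F = (d : ℤ) - 1) ↔ (sdim F + 1 = ((d + 1 : ℕ) : ℤ) - 1) := by
    push_cast; constructor <;> intro h <;> linarith
  rw [← hcast]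
  refine and_congr_left fun _ => ?_
  constructor
  · rintro ⟨hext, -, hcl⟩
    refine ⟨⟨?_, ?_⟩, convex_convexHull _ _, ?_⟩
    · rw [hQ]; exact convexHull_mono (insert_subset_insert hFS)
    · intro p hp q hq z hz hzo
      rw [hQ, brx_mem_insert (convex_convexHull _ _) hBne] at hp hq
      obtain ⟨s, hs0, hs1, b, hb, rfl⟩ := hp
      obtain ⟨t, ht0, ht1, c, hc, rfl⟩ := hq
      obtain ⟨u, hu0, hu1, w, hw, rfl⟩ := (brx_mem_insert hF hne z).1 hz
      obtain ⟨α, β, hα, hβ, hαβ, he⟩ := hzo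
      obtain ⟨f, k, hf, hfa⟩ := brx_exists_functional hSne ha
      have eb := hf _ (convexHull_subset_affineSpan S hb)
      have ec := hf _ (convexHull_subset_affineSpan S hc)
      have ew := hf _ (brx_sub_aff hFS hw)
      have hu : u = α * s + β * t := by
        have := congrArg f he
        simp only [map_add, map_smul, smul_eq_mul, hfa, eb, ec, ew] at this
        have hβ' : β = 1 - α := by linarith
        subst hβ'
        linarith
      have hvec : u • w = (α * s) • b + (β * t) • c := by
        have h1 : (α * (1 - s) + β * (1 - t)) • a + ((α * s) • b + (β * t) • c)
            = (1 - u) • a + u • w := by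
          rw [← he]; module
        have h2 : α * (1 - s) + β * (1 - t) = 1 - u := by rw [hu]; linarith
        rw [h2] at h1
        exact (add_left_cancel h1).symm
      rw [brx_mem_insert hF hne]
      rcases eq_or_lt_of_le hs0 with hs | hs
      · refine ⟨0, le_rfl, zero_le_one, w, hw, ?_⟩
        rw [← hs]; simp
      · refine ⟨s, hs0, hs1, b, ?_, rfl⟩
        have hupos : 0 < u := by rw [hu]; positivity
        have hw' : w = (α * s / u) • b + (β * t / u) • c := by
          have : w = u⁻¹ • (u • w) := by rw [smul_smul, inv_mul_cancel₀ hupos.ne', one_smul]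
          rw [this, hvec, smul_add, smul_smul, smul_smul]
          congr 2 <;> ring
        rcases eq_or_lt_of_le ht0 with ht | ht
        · have : α * s / u = 1 := by rw [hu, ← ht]; field_simp; simp
          rw [this, ← ht] at hw'
          simp at hw'
          rwa [← hw']
        · refine hext.2 hb hc hw ⟨α * s / u, β * t / u, by positivity, by positivity, ?_, hw'.symm⟩
          rw [← add_div, ← hu, div_self hupos.ne']
    · have hcomp : IsCompact F := (hS.isCompact_convexHull ℝ).of_isClosed_subset hcl hFS
      have himg : convexHull ℝ (insert a F)
          = (fun q : ℝ × V => (1 - q.1) • a + q.1 • q.2) '' (Icc (0 : ℝ) 1 ×ˢ F) := by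
        ext y
        rw [brx_mem_insert hF hne]
        constructor
        · rintro ⟨t, h0, h1, z, hz, rfl⟩
          exact ⟨(t, z), ⟨⟨h0, h1⟩, hz⟩, rfl⟩
        · rintro ⟨⟨t, z⟩, ⟨⟨h0, h1⟩, hz⟩, rfl⟩
          exact ⟨t, h0, h1, z, hz, rfl⟩
      rw [himg]
      refine IsCompact.isClosed ((isCompact_Icc.prod hcomp).image ?_)
      fun_prop
  · rintro ⟨hext, -, hcl⟩
    refine ⟨⟨hFS, ?_⟩, hF, ?_⟩
    · intro p hp q hq z hz hzo
      refine brx_inter ha hF hne hFS ?_ (convexHull_subset_affineSpan S hp)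
      have hm : convexHull ℝ S ⊆ convexHull ℝ (insert a S) :=
        convexHull_mono (subset_insert _ _)
      exact hext.2 (hm hp) (hm hq) (subset_convexHull ℝ _ (mem_insert_of_mem _ hz)) hzo
    · have : F = convexHull ℝ (insert a F) ∩ convexHull ℝ S := by
        apply subset_antisymm
        · intro y hy
          exact ⟨subset_convexHull ℝ _ (mem_insert_of_mem _ hy), hFS hy⟩
        · rintro y ⟨h1, h2⟩
          exact brx_inter ha hF hne hFS h1 (convexHull_subset_affineSpan S h2)
      rw [this]
      exact hcl.inter (hS.isClosed_convexHull ℝ)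

theorem brx_iter {S : ℕ → Set V} {a : ℕ → V} {m : ℕ} (hfin : ∀ j, (S j).Finite)
    (hS : ∀ j < m, S (j + 1) = insert (a j) (S j))
    (ha : ∀ j < m, a j ∉ affineSpan ℝ (S j)) (k : ℕ) {F : Set V}
    (hF : Convex ℝ F) (hne : F.Nonempty) (hFS : F ⊆ convexHull ℝ (S 0)) :
    ∀ j ≤ m, (IsFacetOf k (convexHull ℝ (S 0)) F ↔
      IsFacetOf (k + j) (convexHull ℝ (S j)) (convexHull ℝ (a '' Iio j ∪ F))) ∧
      convexHull ℝ (a '' Iio j ∪ F) ∩ convexHull ℝ (S 0) ⊆ F ∧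
      convexHull ℝ (a '' Iio j ∪ F) ⊆ convexHull ℝ (S j) ∧ S 0 ⊆ S j := by
  intro j
  induction j with
  | zero =>
    intro _
    have h0 : a '' Iio 0 ∪ F = F := by simp
    rw [h0, hF.convexHull_eq]
    exact ⟨Iff.rfl, inter_subset_left, hFS, Subset.rfl⟩
  | succ j ih =>
    intro hj
    obtain ⟨h1, h2, h3, h4⟩ := ih (by omega)
    have hne' : (convexHull ℝ (a '' Iio j ∪ F)).Nonempty :=
      convexHull_nonempty_iff.2 (hne.mono subset_union_right)
    have hset : a '' Iio (j + 1) ∪ F = insert (a j) (a '' Iio j ∪ F) := by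
      have : Iio (j + 1) = insert j (Iio j) := by
        ext l; simp only [mem_Iio, mem_insert_iff]; omega
      rw [this, image_insert_eq, insert_union]
    have hc : convexHull ℝ (a '' Iio (j + 1) ∪ F)
        = convexHull ℝ (insert (a j) (convexHull ℝ (a '' Iio j ∪ F))) := by
      rw [hset, insert_eq, insert_eq, convexHull_convexHull_union_right]
    have hstep := brx_step (hfin j) (ha j (by omega)) (k + j) (convex_convexHull ℝ _) hne' h3
    refine ⟨?_, ?_, ?_, ?_⟩
    · rw [h1, hstep, hc, hS j (by omega)]; rfl
    · rintro y ⟨hy1, hy2⟩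
      refine h2 ⟨?_, hy2⟩
      rw [hc] at hy1
      exact brx_inter (ha j (by omega)) (convex_convexHull ℝ _) hne' h3 hy1
        (convexHull_subset_affineSpan _ (convexHull_mono h4 hy2))
    · rw [hc, hS j (by omega)]
      refine convexHull_min (insert_subset ?_ ?_) (convex_convexHull ℝ _)
      · exact subset_convexHull ℝ _ (mem_insert _ _)
      · exact h3.trans (convexHull_mono (subset_insert _ _))
    · rw [hS j (by omega)]
      exact h4.trans (subset_insert _ _)

theorem brx_sdim_iter {S : ℕ → Set V} {a : ℕ → V} {m : ℕ} (hfin : ∀ j, (S j).Finite)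
    (hS : ∀ j < m, S (j + 1) = insert (a j) (S j)) (hne : ∀ j, (S j).Nonempty)
    (ha : ∀ j < m, a j ∉ affineSpan ℝ (S j)) :
    ∀ j ≤ m, sdim (convexHull ℝ (S j)) = sdim (convexHull ℝ (S 0)) + j := by
  intro j
  induction j with
  | zero => simp
  | succ j ih =>
    intro hj
    have h := brx_sdim_insert (a := a j) (hfin j) (F := convexHull ℝ (S j)) Subset.rfl
      (convexHull_nonempty_iff.2 (hne j))
      (by rw [affineSpan_convexHull]; exact ha j (by omega))
    have hc : convexHull ℝ (insert (a j) (S j))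
        = convexHull ℝ (insert (a j) (convexHull ℝ (S j))) := by
      rw [insert_eq, insert_eq, convexHull_convexHull_union_right]
    rw [hS j (by omega), hc, h, ih (by omega)]
    push_cast; ring

/-- Vertex array extended to all natural indices. -/
def brxIdx {n : ℕ} (x : Fin (n + 1) → V) (l : ℕ) : V := x ⟨min l n, by omega⟩

theorem brx_xc {n : ℕ} (x : Fin (n + 1) → V) (t : ℤ) : xc x t = brxIdx x t.toNat := by
  unfold xc brxIdx
  congr 2
  omega

theorem brx_Tset (d : ℕ) {n : ℕ} (x : Fin (n + 1) → V) (i : ℤ) (hi : 0 ≤ i) :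
    Tset d x i = brxIdx x '' {l : ℕ | i ≤ l ∧ (l : ℤ) ≤ i + d - 1} := by
  unfold Tset
  ext v
  constructor
  · rintro ⟨t, ⟨h1, h2⟩, rfl⟩
    refine ⟨t.toNat, ⟨by omega, by omega⟩, (brx_xc x t).symm⟩
  · rintro ⟨l, ⟨h1, h2⟩, rfl⟩
    exact ⟨(l : ℤ), ⟨h1, h2⟩, by rw [brx_xc]; simp⟩

/-- Index set of `E_j`. -/
def brxE (d n : ℕ) (j : ℤ) : Set ℕ :=
  {l : ℕ | l ≤ n ∧ (l = 0 ∨ (j - (d - 2) ≤ l ∧ (l : ℤ) ≤ j + (d - 2) ∧ (l : ℤ) ≠ j) ∨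
    (l = n ∧ j = n))}

theorem brx_Eset (d : ℕ) (hd : 3 ≤ d) {n : ℕ} (x : Fin (n + 1) → V) (j : ℤ) (hj : 2 ≤ j)
    (hjn : j ≤ n) : Eset d x j = brxIdx x '' brxE d n j := by
  have h00 : x 0 = brxIdx x 0 := by
    unfold brxIdx; congr 1
  unfold Eset brxE
  ext v
  constructor
  · rintro (rfl | ⟨t, ⟨⟨h1, h2⟩, h3⟩, rfl⟩)
    · exact ⟨0, ⟨by omega, Or.inl rfl⟩, h00.symm⟩
    · simp only [mem_singleton_iff] at h3
      refine ⟨min t.toNat n, ⟨by omega, by omega⟩, ?_⟩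
      rw [brx_xc]; unfold brxIdx; congr 2; omega
  · rintro ⟨l, ⟨h0, h | ⟨h1, h2, h3⟩ | ⟨h1, h2⟩⟩, rfl⟩
    · left; rw [h, h00]
    · right
      exact ⟨(l : ℤ), ⟨⟨h1, h2⟩, h3⟩, by rw [brx_xc]; simp⟩
    · right
      refine ⟨(n : ℤ) + 1, ⟨⟨by omega, by omega⟩, ?_⟩, ?_⟩
      · simp only [mem_singleton_iff]; omega
      · rw [brx_xc]; unfold brxIdx; congr 2; omega

theorem brx_range {n : ℕ} (x : Fin (n + 1) → V) :
    Set.range x = brxIdx x '' {l | l ≤ n} := by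
  ext v
  constructor
  · rintro ⟨i, rfl⟩
    refine ⟨i, Nat.lt_succ_iff.1 i.isLt, ?_⟩
    unfold brxIdx
    congr 1; ext; simp; omega
  · rintro ⟨l, _, rfl⟩
    exact ⟨_, rfl⟩

/-- Reindexing the sub-array. -/
theorem brx_reindex {n n' k m : ℕ} {x : Fin (n + 1) → V} {y : Fin (n' + 1) → V}
    (hxy : ∀ l ≤ n', brxIdx y l = brxIdx x (if l < k then l else l + m))
    (I : Set ℕ) (hI : ∀ l ∈ I, l ≤ n') (G : Set ℕ)
    (hG : ∀ l, l ∈ G ↔ ((k ≤ l ∧ l < k + m) ∨ (l < k ∧ l ∈ I) ∨ (k + m ≤ l ∧ l - m ∈ I))) :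
    brxIdx x '' G = brxIdx x '' {l | k ≤ l ∧ l < k + m} ∪ brxIdx y '' I := by
  ext v
  constructor
  · rintro ⟨l, hl, rfl⟩
    rcases (hG l).1 hl with h | ⟨h1, h2⟩ | ⟨h1, h2⟩
    · exact Or.inl ⟨l, h, rfl⟩
    · refine Or.inr ⟨l, h2, ?_⟩
      rw [hxy l (hI l h2), if_pos h1]
    · refine Or.inr ⟨l - m, h2, ?_⟩
      rw [hxy _ (hI _ h2), if_neg (by omega)]
      congr 1; omega
  · rintro (⟨l, h, rfl⟩ | ⟨l, h, rfl⟩)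
    · exact ⟨l, (hG l).2 (Or.inl h), rfl⟩
    · refine ⟨if l < k then l else l + m, ?_, (hxy l (hI l h)).symm⟩
      rw [hG]
      split_ifs with h1
      · exact Or.inr (Or.inl ⟨h1, h⟩)
      · refine Or.inr (Or.inr ⟨by omega, ?_⟩)
        rwa [Nat.add_sub_cancel]

theorem brx_core (d n k m n' : ℕ) (hk2 : 2 ≤ k) (hm : 1 ≤ m) (hdk : d = k + m)
    (hd : 3 ≤ d)
    (hnk : n + 2 = d + k) (hn' : n' + 2 = 2 * k) (x : Fin (n + 1) → V) (y : Fin (n' + 1) → V)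
    (hxy : ∀ l ≤ n', brxIdx y l = brxIdx x (if l < k then l else l + m))
    (hx : IsBraxtope d n x) :
    IsBraxtope k n' y ∧
    ∃ Qs : ℕ → Set V,
      Qs 0 = convexHull ℝ (Set.range y) ∧
      Qs m = braxQ x ∧
      ∀ j : ℕ, j < m → IsPyramidOver (Qs (j + 1)) (Qs j) (brxIdx x (k + j)) := by
  obtain ⟨hdn, hinj, hdim, hext, hfac⟩ := hx.2 hd
  have hidx : ∀ l ≤ n, ∀ l' ≤ n, brxIdx x l = brxIdx x l' → l = l' := by
    intro l hl l' hl' h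
    have := hinj h
    simp only [Fin.mk.injEq] at this
    omega
  have hapex : ∀ j : ℕ, k ≤ j → j < d →
      brxIdx x j ∉ affineSpan ℝ (brxIdx x '' {l | l ≤ n ∧ l ≠ j}) := by
    intro j hj1 hj2 hmem
    have hE : Eset d x (j : ℤ) = brxIdx x '' {l | l ≤ n ∧ l ≠ j} := by
      rw [brx_Eset d hd x j (by omega) (by omega)]
      congr 1
      ext l
      simp only [brxE, mem_ofPred_eq]
      omega
    have hf := (hfac (convexHull ℝ (Eset d x (j : ℤ)))).2
      (Or.inr ⟨j, by omega, by omega, rfl⟩)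
    have hs := hf.2
    have hins : Set.range x = insert (brxIdx x j) (brxIdx x '' {l | l ≤ n ∧ l ≠ j}) := by
      rw [brx_range, ← image_insert_eq]
      congr 1
      ext l
      simp only [mem_ofPred_eq, mem_insert_iff]
      omega
    have hne1 : (convexHull ℝ (Set.range x)).Nonempty :=
      convexHull_nonempty_iff.2 (Set.range_nonempty x)
    have hne2 : (convexHull ℝ (Eset d x (j : ℤ))).Nonempty :=
      convexHull_nonempty_iff.2 ⟨_, mem_insert _ _⟩
    unfold braxQ at hdim
    unfold sdim at hs hdim
    rw [if_pos hne1, affineSpan_convexHull, hins, affineSpan_insert_eq_affineSpan ℝ hmem] at hdim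
    rw [if_pos hne2, affineSpan_convexHull, hE] at hs
    omega
  set S : ℕ → Set V := fun j => brxIdx x '' {l | l ≤ n ∧ (l < k + j ∨ d ≤ l)} with hSdef
  set a : ℕ → V := fun j => brxIdx x (k + j) with hadef
  have hfin : ∀ j, (S j).Finite := fun j =>
    ((Set.finite_Iic n).subset (fun l hl => hl.1)).image _
  have hSne : ∀ j, (S j).Nonempty := fun j =>
    ⟨_, ⟨0, ⟨by omega, by omega⟩, rfl⟩⟩
  have hS : ∀ j < m, S (j + 1) = insert (a j) (S j) := by
    intro j hj
    simp only [hSdef, hadef]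
    rw [← image_insert_eq]
    congr 1
    ext l
    simp only [mem_ofPred_eq, mem_insert_iff]
    omega
  have ha : ∀ j < m, a j ∉ affineSpan ℝ (S j) := by
    intro j hj h
    refine hapex (k + j) (by omega) (by omega) (affineSpan_mono ℝ ?_ h)
    apply image_mono
    rintro l ⟨h1, h2⟩
    exact ⟨h1, by omega⟩
  have hSm : S m = Set.range x := by
    rw [brx_range]
    simp only [hSdef]
    congr 1
    ext l
    simp only [mem_ofPred_eq]
    omega
  have hS0 : S 0 = Set.range y := by
    rw [brx_range]
    ext v
    constructor
    · rintro ⟨l, ⟨h1, h2⟩, rfl⟩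
      by_cases h : l < k
      · exact ⟨l, by simp only [mem_ofPred_eq]; omega, by rw [hxy l (by omega), if_pos h]⟩
      · refine ⟨l - m, by simp only [mem_ofPred_eq]; omega, ?_⟩
        rw [hxy _ (by omega), if_neg (by omega)]
        congr 1; omega
    · rintro ⟨l, hl, rfl⟩
      simp only [mem_ofPred_eq] at hl
      refine ⟨if l < k then l else l + m, ?_, (hxy l hl).symm⟩
      simp only [mem_ofPred_eq]
      split_ifs <;> omega
  have hA : a '' Iio m = brxIdx x '' {l | k ≤ l ∧ l < k + m} := by
    ext v
    constructor
    · rintro ⟨l, hl, rfl⟩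
      simp only [mem_Iio] at hl
      exact ⟨k + l, by simp only [mem_ofPred_eq]; omega, rfl⟩
    · rintro ⟨l, ⟨h1, h2⟩, rfl⟩
      refine ⟨l - k, by simp only [mem_Iio]; omega, ?_⟩
      simp only [hadef]
      congr 1; omega
  have hyinj : Function.Injective y := by
    intro i i' h
    have e : ∀ i : Fin (n' + 1), y i = brxIdx y i := by
      intro i
      unfold brxIdx; congr 1; ext; simp; omega
    rw [e, e, hxy _ (by omega), hxy _ (by omega)] at h
    have h' := hidx _ (by split_ifs <;> omega) _ (by split_ifs <;> omega) h
    ext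
    split_ifs at h' <;> omega
  have hydim : sdim (convexHull ℝ (Set.range y)) = k := by
    have := brx_sdim_iter hfin hS hSne ha m le_rfl
    unfold braxQ at hdim
    rw [hSm, hS0, hdim] at this
    rw [hdk] at this
    push_cast at this
    linarith
  refine ⟨⟨?_, ?_⟩, ?_⟩
  · intro hk
    have hkn : n' = k := by omega
    refine ⟨hkn, ?_⟩
    rw [affineIndependent_iff_finrank_vectorSpan_eq ℝ y (n := n') (by simp)]
    unfold sdim at hydim
    rw [if_pos (convexHull_nonempty_iff.2 (Set.range_nonempty y)), affineSpan_convexHull,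
      direction_affineSpan] at hydim
    omega
  · intro hk3
    refine ⟨by omega, hyinj, hydim, ?_, ?_⟩
    · intro i
      have hsub : braxQ y ⊆ braxQ x := by
        unfold braxQ
        rw [← hS0, ← hSm]
        apply convexHull_mono
        apply image_mono
        rintro l ⟨h1, h2⟩
        exact ⟨h1, by omega⟩
      refine inter_extremePoints_subset_extremePoints_of_subset hsub
        ⟨subset_convexHull ℝ _ (mem_range_self i), ?_⟩
      have : y i ∈ Set.range x := by
        rw [← hSm]
        have h0 : y i ∈ S 0 := hS0 ▸ mem_range_self i
        obtain ⟨l, ⟨h1, h2⟩, h3⟩ := h0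
        exact ⟨l, ⟨h1, by omega⟩, h3⟩
      obtain ⟨i', hi'⟩ := this
      rw [← hi']
      exact hext i'
    · have hT : ∀ i : ℤ, 0 ≤ i → i ≤ (n' : ℤ) - k + 1 →
          Tset d x i = a '' Iio m ∪ Tset k y i := by
        intro i h0 h1
        rw [brx_Tset d x i h0, brx_Tset k y i h0, hA]
        apply brx_reindex hxy
        · rintro l ⟨h2, h3⟩; omega
        · intro l
          simp only [mem_ofPred_eq]
          omega
      have hE1 : ∀ j : ℤ, 2 ≤ j → j < k → Eset d x j = a '' Iio m ∪ Eset k y j := by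
        intro j h0 h1
        rw [brx_Eset d hd x j h0 (by omega), brx_Eset k hk3 y j h0 (by omega), hA]
        apply brx_reindex hxy
        · rintro l ⟨h2, h3⟩; omega
        · intro l
          simp only [brxE, mem_ofPred_eq]
          omega
      have hE2 : ∀ j : ℤ, k ≤ j → j ≤ n' → Eset d x (j + m) = a '' Iio m ∪ Eset k y j := by
        intro j h0 h1
        rw [brx_Eset d hd x _ (by omega) (by omega), brx_Eset k hk3 y j (by omega) h1, hA]
        apply brx_reindex hxy
        · rintro l ⟨h2, h3⟩; omega
        · intro l
          simp only [brxE, mem_ofPred_eq]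
          omega
      have hTy : ∀ i : ℤ, Tset k y i ⊆ Set.range y := by
        rintro i _ ⟨t, _, rfl⟩
        exact ⟨_, rfl⟩
      have hEy : ∀ i : ℤ, Eset k y i ⊆ Set.range y := by
        rintro i _ (rfl | ⟨t, _, rfl⟩)
        · exact ⟨_, rfl⟩
        · exact ⟨_, rfl⟩
      have hiff : ∀ F : Set V, Convex ℝ F → F.Nonempty → F ⊆ convexHull ℝ (Set.range y) →
          (IsFacetOf k (braxQ y) F ↔
            IsFacetOf d (braxQ x) (convexHull ℝ (a '' Iio m ∪ F))) := by
        intro F h1 h2 h3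
        have := (brx_iter hfin hS ha k h1 h2 (by rw [hS0]; exact h3) m le_rfl).1
        rw [hS0, hSm, ← hdk] at this
        exact this
      have heq : ∀ F F' : Set V, Convex ℝ F → F.Nonempty → F ⊆ convexHull ℝ (Set.range y) →
          Convex ℝ F' → F'.Nonempty → F' ⊆ convexHull ℝ (Set.range y) →
          convexHull ℝ (a '' Iio m ∪ F) = convexHull ℝ (a '' Iio m ∪ F') → F = F' := by
        intro F F' h1 h2 h3 h1' h2' h3' he
        rw [← hS0] at h3 h3'
        have e1 := (brx_iter hfin hS ha k h1 h2 h3 m le_rfl).2.1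
        have e2 := (brx_iter hfin hS ha k h1' h2' h3' m le_rfl).2.1
        apply subset_antisymm
        · intro v hv
          exact e2 ⟨he ▸ subset_convexHull ℝ _ (Or.inr hv), h3 hv⟩
        · intro v hv
          exact e1 ⟨he ▸ subset_convexHull ℝ _ (Or.inr hv), h3' hv⟩
      have hG : ∀ G G' : Set V, G ⊆ Set.range y → G.Nonempty → G' = a '' Iio m ∪ G →
          IsFacetOf d (braxQ x) (convexHull ℝ G') →
          IsFacetOf k (braxQ y) (convexHull ℝ G) := by
        intro G G' h1 h2 h3 h4
        rw [hiff _ (convex_convexHull ℝ _) (convexHull_nonempty_iff.2 h2) (convexHull_mono h1),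
          convexHull_convexHull_union_right, ← h3]
        exact h4
      have hG' : ∀ F G G' : Set V, Convex ℝ F → F.Nonempty → F ⊆ convexHull ℝ (Set.range y) →
          G ⊆ Set.range y → G.Nonempty → G' = a '' Iio m ∪ G →
          convexHull ℝ (a '' Iio m ∪ F) = convexHull ℝ G' → F = convexHull ℝ G := by
        intro F G G' h1 h2 h3 h4 h5 h6 h7
        refine heq _ _ h1 h2 h3 (convex_convexHull ℝ _) (convexHull_nonempty_iff.2 h5)
          (convexHull_mono h4) ?_
        rw [convexHull_convexHull_union_right, h7, h6]
      have hTne : ∀ i : ℤ, (Tset k y i).Nonempty := fun i =>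
        ⟨_, ⟨i, ⟨le_rfl, by omega⟩, rfl⟩⟩
      have hEne : ∀ i : ℤ, (Eset k y i).Nonempty := fun i => ⟨_, mem_insert _ _⟩
      intro F
      constructor
      · intro hFf
        have hFc : Convex ℝ F := hFf.1.2.1
        have hFs : F ⊆ convexHull ℝ (Set.range y) := hFf.1.1.1
        have hFne : F.Nonempty := by
          by_contra hcon
          have := hFf.2
          unfold sdim at this
          rw [if_neg hcon] at this
          omega
        rcases (hfac _).1 ((hiff F hFc hFne hFs).1 hFf) with ⟨i, h0, h1, h2⟩ | ⟨j, h0, h1, h2⟩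
        · left
          exact ⟨i, h0, by omega, hG' F _ _ hFc hFne hFs (hTy i) (hTne i)
            (hT i h0 (by omega)) h2⟩
        · right
          by_cases hj1 : j < k
          · exact ⟨j, h0, by omega, hG' F _ _ hFc hFne hFs (hEy j) (hEne j) (hE1 j h0 hj1) h2⟩
          by_cases hj2 : j < d
          · exfalso
            have hmem : brxIdx x j.toNat ∈ convexHull ℝ (Eset d x j) := by
              rw [← h2, hA]
              exact subset_convexHull ℝ _ (Or.inl ⟨j.toNat, ⟨by omega, by omega⟩, rfl⟩)
            refine hapex j.toNat (by omega) (by omega)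
              (affineSpan_mono ℝ ?_ (convexHull_subset_affineSpan _ hmem))
            rw [brx_Eset d hd x j h0 h1]
            apply image_mono
            rintro l ⟨h3, h4⟩
            refine ⟨h3, ?_⟩
            omega
          · have := hE2 (j - m) (by omega) (by omega)
            rw [sub_add_cancel] at this
            exact ⟨j - m, by omega, by omega, hG' F _ _ hFc hFne hFs (hEy _) (hEne _) this h2⟩
      · rintro (⟨i, h0, h1, rfl⟩ | ⟨j, h0, h1, rfl⟩)
        · exact hG _ _ (hTy i) (hTne i) (hT i h0 h1)
            ((hfac _).2 (Or.inl ⟨i, h0, by omega, rfl⟩))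
        · by_cases hj : j < k
          · exact hG _ _ (hEy j) (hEne j) (hE1 j h0 hj)
              ((hfac _).2 (Or.inr ⟨j, h0, by omega, rfl⟩))
          · exact hG _ _ (hEy j) (hEne j) (hE2 j (by omega) h1)
              ((hfac _).2 (Or.inr ⟨j + m, by omega, by omega, rfl⟩))
  · refine ⟨fun j => convexHull ℝ (S j), by simp only [hS0], by simp only [hSm]; rfl, ?_⟩
    intro j hj
    refine ⟨?_, ?_⟩
    · simp only
      rw [hS j hj, insert_eq, insert_eq, convexHull_convexHull_union_right]
    · simp only
      rw [affineSpan_convexHull]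
      exact ha j hj

/-- For `d ≤ n ≤ 2d - 3`, the `d`-braxtope `Q^{d,n}` is a `(2d-2-n)`-fold
pyramid over the `(n-d+2)`-braxtope `[x_0, …, x_{n-d+1}, x_d, …, x_n]`, with
apices `x_{n-d+2}, …, x_{d-1}`. -/
theorem braxtope_multifold_pyramid (d n : ℕ) (hd : 3 ≤ d) (hn : d ≤ n)
    (hub : n ≤ 2 * d - 3) (x : Fin (n + 1) → V) (hx : IsBraxtope d n x) :
    IsBraxtope (n - d + 2) (2 * (n - d) + 2)
      (fun i : Fin (2 * (n - d) + 2 + 1) =>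
        x ⟨if (i : ℕ) ≤ n - d + 1 then (i : ℕ) else (i : ℕ) + (2 * d - n - 2),
          by have := i.isLt; split <;> omega⟩) ∧
    ∃ Qs : ℕ → Set V,
      Qs 0 = convexHull ℝ (Set.range
        (fun i : Fin (2 * (n - d) + 2 + 1) =>
          x ⟨if (i : ℕ) ≤ n - d + 1 then (i : ℕ) else (i : ℕ) + (2 * d - n - 2),
            by have := i.isLt; split <;> omega⟩)) ∧
      Qs (2 * d - 2 - n) = braxQ x ∧
      ∀ j : ℕ, j < 2 * d - 2 - n →
        IsPyramidOver (Qs (j + 1)) (Qs j) (x ⟨min (n - d + 2 + j) n, by omega⟩) := by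
  have hm : 2 * d - 2 - n = 2 * d - n - 2 := by omega
  rw [hm]
  have hcore := brx_core d n (n - d + 2) (2 * d - n - 2) (2 * (n - d) + 2) (by omega) (by omega)
    (by omega) hd (by omega) (by omega) x
    (fun i : Fin (2 * (n - d) + 2 + 1) =>
        x ⟨if (i : ℕ) ≤ n - d + 1 then (i : ℕ) else (i : ℕ) + (2 * d - n - 2),
          by have := i.isLt; split <;> omega⟩) ?_ hx
  · exact hcore
  · intro l hl
    unfold brxIdx
    refine congrArg x (Fin.ext ?_)
    simp only
    rw [min_eq_left hl]
    split_ifs <;> omega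
end
end
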